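/- Let u be a weak solution of ∂_t u = (1/2) u ∂_x² u on [0,T). Then on the open set P := {(t,x) ∈ (0,T) × ℝ : u(t,x) > 0}, the function u is infinitely differentiable and satisfies the equation ∂_t u = (1/2) u ∂_x² u pointwise. -/

import Mathlib

open MeasureTheory Set Filter

noncomputable section

/-- Regularity requirements in the definition of a weak solution of
`∂ₜ u = (1/2) u ∂ₓ² u` on `[0,T) × ℝ`: continuity on `[0,T) × ℝ`, local Lipschitz
continuity of `u(t,·)`, and continuity of `t ↦ u(t,·)` into `W^{1,∞}_loc(ℝ)`. -/
def RegWeak (T : ℝ) (u : ℝ → ℝ → ℝ) : Prop :=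
  ContinuousOn (Function.uncurry u) (Ico 0 T ×ˢ (univ : Set ℝ)) ∧
  (∀ t ∈ Ico (0:ℝ) T, ∀ R : ℝ, 0 < R →
    ∃ L : NNReal, LipschitzOnWith L (u t) (Icc (-R) R)) ∧
  (∀ t₀ ∈ Ico (0:ℝ) T, ∀ R : ℝ, 0 < R →
    Tendsto (fun t => ⨆ x : Icc (-R) R,
        (|u t x.1 - u t₀ x.1| + |deriv (u t) x.1 - deriv (u t₀) x.1|))
      (nhdsWithin t₀ (Ico 0 T)) (nhds 0))

/-- The weak (integral) formulation of `∂ₜ u = (1/2) u ∂ₓ² u` on `[0,T) × ℝ`,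
tested against every `ψ ∈ C_c^∞([0,T) × ℝ)`. -/
def WeakForm (T : ℝ) (u : ℝ → ℝ → ℝ) : Prop :=
  ∀ ψ : ℝ → ℝ → ℝ,
    ContDiff ℝ (⊤ : ℕ∞) (Function.uncurry ψ) →
    HasCompactSupport (Function.uncurry ψ) →
    tsupport (Function.uncurry ψ) ⊆ Iio T ×ˢ (univ : Set ℝ) →
    (∫ x : ℝ, u 0 x * ψ 0 x) +
      (∫ t in Ico (0:ℝ) T, ∫ x : ℝ,
        (u t x * deriv (fun s => ψ s x) t
          - (1/2) * deriv (fun y => ψ t y * u t y) x * deriv (u t) x)) = 0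

/-- A weak solution of `∂ₜ u = (1/2) u ∂ₓ² u` on `[0,T) × ℝ`. -/
def IsWeakSolution (T : ℝ) (u : ℝ → ℝ → ℝ) : Prop :=
  (∀ t ∈ Ico (0:ℝ) T, ∀ x : ℝ, 0 ≤ u t x) ∧ RegWeak T u ∧ WeakForm T u

/-- `sup_{[0,T']×ℝ} ⟨x⟩⁻² u < ∞`, i.e. `u(t,x) ≤ M (x²+1)` on `[0,T'] × ℝ`. -/
def QuadBoundOn (u : ℝ → ℝ → ℝ) (T' : ℝ) : Prop :=
  ∃ M : ℝ, ∀ t ∈ Icc (0:ℝ) T', ∀ x : ℝ, u t x ≤ M * (x ^ 2 + 1)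

/-- For a.e. `t ∈ (0,T']` the function `u(t,·)` is twice differentiable, and
`t ↦ ess sup_x |∂ₓ² u(t,x)|` is integrable on `[0,T']` (expressed via an
integrable majorant `g`). -/
def SecondDerivIntegrableOn (u : ℝ → ℝ → ℝ) (T' : ℝ) : Prop :=
  ∃ g : ℝ → ℝ, IntegrableOn g (Icc (0:ℝ) T') ∧
    ∀ᵐ t ∂(volume.restrict (Ioc (0:ℝ) T')),
      (∀ x : ℝ, DifferentiableAt ℝ (u t) x ∧ DifferentiableAt ℝ (deriv (u t)) x) ∧
      (∀ x : ℝ, |deriv (deriv (u t)) x| ≤ g t)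

/-- A strong solution of `∂ₜ u = (1/2) u ∂ₓ² u` on `[0,T) × ℝ`. -/
def IsStrongSolution (T : ℝ) (u : ℝ → ℝ → ℝ) : Prop :=
  IsWeakSolution T u ∧
  ∀ T' : ℝ, 0 < T' → T' < T → QuadBoundOn u T' ∧ SecondDerivIntegrableOn u T'

/-- Second-order necessary condition at an interior maximum. -/
theorem deriv2_nonpos_of_isLocalMax {g g' : ℝ → ℝ} {g'' s : ℝ}
    (h : IsLocalMax g s) (h1 : ∀ᶠ y in nhds s, HasDerivAt g (g' y) y)
    (h2 : HasDerivAt g' g'' s) : g'' ≤ 0 := by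
  by_contra! hpos
  have e1 : deriv g =ᶠ[nhds s] g' := h1.mono fun y hy => hy.deriv
  have e2 : deriv (deriv g) s = g'' := by rw [e1.deriv_eq, h2.deriv]
  have hmin := isLocalMin_of_deriv_deriv_pos (f := g) (x₀ := s) (by rw [e2]; exact hpos)
    h.deriv_eq_zero h1.self_of_nhds.continuousAt
  have hc : g =ᶠ[nhds s] fun _ => g s := by
    filter_upwards [h, hmin] with y hy hy'
    exact le_antisymm hy hy'
  have e3 : deriv g =ᶠ[nhds s] fun _ => 0 := by
    simpa using hc.deriv
  have : deriv (deriv g) s = 0 := by rw [e3.deriv_eq]; simp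
  linarith

/-- A function on the left of a point, bounded there by its value at the point, has a
nonnegative derivative. -/
theorem deriv_nonneg_of_left_max {g : ℝ → ℝ} {g' s r : ℝ} (hr : r < s)
    (h : ∀ y ∈ Icc r s, g y ≤ g s) (h1 : HasDerivAt g g' s) : 0 ≤ g' := by
  have := (hasDerivWithinAt_iff_tendsto_slope' (s := Iio s) (by simp)).1
    (h1.hasDerivWithinAt (s := Iio s))
  refine ge_of_tendsto this ?_
  filter_upwards [Ico_mem_nhdsLT hr] with y hy
  rw [slope_def_field]
  exact div_nonneg_of_nonpos (by linarith [h y ⟨hy.1, hy.2.le⟩]) (by linarith [hy.2])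

section DoublingVariables

variable {w wt wx wxx a : ℝ → ℝ → ℝ} {t₀ x₀ ρ m M A F : ℝ}

set_option maxHeartbeats 1000000 in
theorem doubling_bound (hρ : 0 < ρ) (hm : 0 < m) (hA : 0 ≤ A)
    (hc : ContinuousOn (Function.uncurry w) (Icc (t₀ - ρ ^ 2) t₀ ×ˢ Icc (x₀ - ρ) (x₀ + ρ)))
    (ht : ∀ t ∈ Icc (t₀ - ρ ^ 2) t₀, ∀ x ∈ Icc (x₀ - ρ) (x₀ + ρ),
      HasDerivAt (fun s => w s x) (wt t x) t)
    (hx : ∀ t ∈ Icc (t₀ - ρ ^ 2) t₀, ∀ x ∈ Icc (x₀ - ρ) (x₀ + ρ), HasDerivAt (w t) (wx t x) x)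
    (hxx : ∀ t ∈ Icc (t₀ - ρ ^ 2) t₀, ∀ x ∈ Icc (x₀ - ρ) (x₀ + ρ),
      HasDerivAt (wx t) (wxx t x) x)
    (hwA : ∀ t ∈ Icc (t₀ - ρ ^ 2) t₀, ∀ x ∈ Icc (x₀ - ρ) (x₀ + ρ), |w t x| ≤ A)
    (hF : ∀ t ∈ Icc (t₀ - ρ ^ 2) t₀, ∀ x ∈ Icc (x₀ - ρ) (x₀ + ρ),
      |wt t x - 1 / 2 * a t x * wxx t x| ≤ F)
    (ha : ∀ t ∈ Icc (t₀ - ρ ^ 2) t₀, ∀ x ∈ Icc (x₀ - ρ) (x₀ + ρ), m ≤ a t x ∧ a t x ≤ M)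
    {K : ℝ} (hK : 2 * ρ / m * (2 * A * (2 * M + 1) / ρ ^ 2 + 2 * F) < K)
    {x : ℝ} (hx1 : x₀ ≤ x) (hx2 : x ≤ x₀ + ρ) :
    w t₀ x - w t₀ x₀ ≤ K * (x - x₀) + 2 * A / ρ ^ 2 * (x - x₀) ^ 2 := by
  set l : ℝ := 2 * A / ρ ^ 2 with hl
  have hl0 : 0 ≤ l := by positivity
  have hlρ : l * ρ ^ 2 = 2 * A := by rw [hl]; field_simp
  have hF0 : 0 ≤ F :=
    (abs_nonneg _).trans (hF t₀ ⟨by nlinarith, le_rfl⟩ x₀ ⟨by linarith, by linarith⟩)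
  have hmM : m ≤ M := by
    have := ha t₀ ⟨by nlinarith, le_rfl⟩ x₀ ⟨by linarith, by linarith⟩; linarith
  have hK' : l * (2 * M + 1) + 2 * F < K * m / (2 * ρ) := by
    rw [lt_div_iff₀ (by positivity)]
    rw [div_mul_eq_mul_div, div_lt_iff₀ hm] at hK
    have : l * (2 * M + 1) = 2 * A * (2 * M + 1) / ρ ^ 2 := by rw [hl]; ring
    rw [this]; linarith
  have hK0 : 0 < K := by
    refine lt_of_le_of_lt ?_ hK
    have : 0 ≤ M := by linarith
    positivity
  let P : ℝ × ℝ × ℝ → ℝ := fun q => w q.1 q.2.1 - w q.1 q.2.2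
    - K * ((q.2.1 - q.2.2) - (q.2.1 - q.2.2) ^ 2 / (8 * ρ))
    - l * ((q.2.1 - x₀) ^ 2 + (q.2.2 - x₀) ^ 2 + (t₀ - q.1))
  let D : Set (ℝ × ℝ × ℝ) := {q | q.1 ∈ Icc (t₀ - ρ ^ 2) t₀ ∧ q.2.1 ∈ Icc (x₀ - ρ) (x₀ + ρ) ∧
    q.2.2 ∈ Icc (x₀ - ρ) (x₀ + ρ) ∧ q.2.2 ≤ q.2.1}
  have hD : IsCompact D := by
    have : D = (Icc (t₀ - ρ ^ 2) t₀ ×ˢ Icc (x₀ - ρ) (x₀ + ρ) ×ˢ Icc (x₀ - ρ) (x₀ + ρ)) ∩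
        {q | q.2.2 ≤ q.2.1} := by
      ext q; simp only [D, mem_ofPred_eq, mem_inter_iff, mem_prod]; tauto
    rw [this]
    exact (isCompact_Icc.prod (isCompact_Icc.prod isCompact_Icc)).inter_right
      (isClosed_le (by fun_prop) (by fun_prop))
  have hPc : ContinuousOn P D := by
    have h1 : ContinuousOn (fun q : ℝ × ℝ × ℝ => w q.1 q.2.1) D :=
      hc.comp (f := fun q : ℝ × ℝ × ℝ => (q.1, q.2.1)) (by fun_prop) fun q hq => ⟨hq.1, hq.2.1⟩
    have h2 : ContinuousOn (fun q : ℝ × ℝ × ℝ => w q.1 q.2.2) D :=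
      hc.comp (f := fun q : ℝ × ℝ × ℝ => (q.1, q.2.2)) (by fun_prop) fun q hq => ⟨hq.1, hq.2.2.1⟩
    exact ((h1.sub h2).sub (by fun_prop)).sub (by fun_prop)
  have hq0 : (t₀, x, x₀) ∈ D :=
    ⟨⟨by nlinarith, le_rfl⟩, ⟨by linarith, hx2⟩, ⟨by linarith, by linarith⟩, hx1⟩
  obtain ⟨⟨t, y, z⟩, hqD, hmax⟩ := hD.exists_isMaxOn ⟨_, hq0⟩ hPc
  have hle : P (t, y, z) ≤ 0 := by
    by_contra! hpos
    obtain ⟨htI, hyI, hzI, hzy⟩ := hqD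
    simp only at htI hyI hzI hzy
    have hψ : ∀ s, 0 ≤ s → s ≤ 2 * ρ → 0 ≤ K * (s - s ^ 2 / (8 * ρ)) := by
      intro s h0 h1
      refine mul_nonneg hK0.le ?_
      rw [sub_nonneg, div_le_iff₀ (by positivity)]
      nlinarith
    have hψ' := hψ (y - z) (by linarith) (by linarith [hyI.2, hzI.1])
    have hw2 : w t y - w t z ≤ 2 * A := by
      have h1 := abs_le.1 (hwA t htI y hyI)
      have h2 := abs_le.1 (hwA t htI z hzI)
      linarith [h1.2, h2.1]
    have hrest : (y - x₀) ^ 2 + (z - x₀) ^ 2 + (t₀ - t) < ρ ^ 2 := by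
      by_contra! hge
      have := mul_le_mul_of_nonneg_left hge hl0
      simp only [P] at hpos
      linarith
    have hzy' : z < y := by
      refine lt_of_le_of_ne hzy fun h => ?_
      subst h
      simp only [P] at hpos
      have : 0 ≤ l * ((z - x₀) ^ 2 + (z - x₀) ^ 2 + (t₀ - t)) :=
        mul_nonneg hl0 (by nlinarith [htI.2, sq_nonneg (z - x₀)])
      simp at hpos
      linarith
    have hyI' : y ∈ Ioo (x₀ - ρ) (x₀ + ρ) := by
      have : |y - x₀| < ρ := abs_lt_of_sq_lt_sq (by nlinarith [htI.2, sq_nonneg (z - x₀)]) hρ.le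
      rw [abs_lt] at this; constructor <;> linarith [this.1, this.2]
    have hzI' : z ∈ Ioo (x₀ - ρ) (x₀ + ρ) := by
      have : |z - x₀| < ρ := abs_lt_of_sq_lt_sq (by nlinarith [htI.2, sq_nonneg (y - x₀)]) hρ.le
      rw [abs_lt] at this; constructor <;> linarith [this.1, this.2]
    have htI' : t₀ - ρ ^ 2 < t := by nlinarith [sq_nonneg (y - x₀), sq_nonneg (z - x₀)]
    -- time derivative
    have hT : 0 ≤ wt t y - wt t z + l := by
      refine deriv_nonneg_of_left_max (g := fun s => P (s, y, z)) htI' ?_ ?_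
      · intro s hs
        exact hmax (⟨⟨hs.1, hs.2.trans htI.2⟩, hyI, hzI, hzy⟩ : (s, y, z) ∈ D)
      · have := ((((ht t htI y hyI).sub (ht t htI z hzI)).sub_const
          (K * ((y - z) - (y - z) ^ 2 / (8 * ρ)))).sub
          ((((hasDerivAt_id t).const_sub t₀).const_add ((y - x₀) ^ 2 + (z - x₀) ^ 2)).const_mul l))
        exact HasDerivAt.congr_deriv this (by ring)
    -- second derivative along the coupling direction
    set p : ℝ := √(a t y) with hp
    set r : ℝ := √(a t z) with hr
    have hay := ha t htI y hyI
    have haz := ha t htI z hzI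
    have hp2 : p ^ 2 = a t y := Real.sq_sqrt (by linarith)
    have hr2 : r ^ 2 = a t z := Real.sq_sqrt (by linarith)
    have hp0 : 0 ≤ p := Real.sqrt_nonneg _
    have hr0 : 0 ≤ r := Real.sqrt_nonneg _
    have hcy : ∀ᶠ s : ℝ in nhds 0, y + s * p ∈ Ioo (x₀ - ρ) (x₀ + ρ) := by
      have : ContinuousAt (fun s : ℝ => y + s * p) 0 := by fun_prop
      exact this.eventually_mem (Ioo_mem_nhds (by simpa using hyI'.1) (by simpa using hyI'.2))
    have hcz : ∀ᶠ s : ℝ in nhds 0, z - s * r ∈ Ioo (x₀ - ρ) (x₀ + ρ) := by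
      have : ContinuousAt (fun s : ℝ => z - s * r) 0 := by fun_prop
      exact this.eventually_mem (Ioo_mem_nhds (by simpa using hzI'.1) (by simpa using hzI'.2))
    have hcyz : ∀ᶠ s : ℝ in nhds 0, z - s * r < y + s * p := by
      have h1 : ContinuousAt (fun s : ℝ => z - s * r) 0 := by fun_prop
      have h2 : ContinuousAt (fun s : ℝ => y + s * p) 0 := by fun_prop
      exact h1.eventually_lt h2 (by simpa using hzy')
    have hS : p ^ 2 * wxx t y - r ^ 2 * wxx t z + K * (p + r) ^ 2 / (4 * ρ)
        - 2 * l * (p ^ 2 + r ^ 2) ≤ 0 := by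
      refine deriv2_nonpos_of_isLocalMax (g := fun s => P (t, y + s * p, z - s * r)) (s := 0)
        (g' := fun s => wx t (y + s * p) * p + wx t (z - s * r) * r
          - K * ((p + r) - (y + s * p - (z - s * r)) * (p + r) / (4 * ρ))
          - l * (2 * (y + s * p - x₀) * p - 2 * (z - s * r - x₀) * r)) ?_ ?_ ?_
      · filter_upwards [hcy, hcz, hcyz] with s h1 h2 h3
        have := hmax (show (t, y + s * p, z - s * r) ∈ D from
          ⟨htI, Ioo_subset_Icc_self h1, Ioo_subset_Icc_self h2, h3.le⟩)
        simpa using this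
      · filter_upwards [hcy, hcz] with s h1 h2
        have d1 : HasDerivAt (fun s : ℝ => y + s * p) p s := by
          simpa using ((hasDerivAt_id s).mul_const p).const_add y
        have d2 : HasDerivAt (fun s : ℝ => z - s * r) (-r) s := by
          simpa using ((hasDerivAt_id s).mul_const r).const_sub z
        have e1 := (hx t htI _ (Ioo_subset_Icc_self h1)).comp s d1
        have e2 := (hx t htI _ (Ioo_subset_Icc_self h2)).comp s d2
        have e3 := ((e1.sub e2).sub (((d1.sub d2).sub (((d1.sub d2).pow 2).div_const
          (8 * ρ))).const_mul K)).sub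
          ((((((d1.sub_const x₀).pow 2).add ((d2.sub_const x₀).pow 2))).add_const
            (t₀ - t)).const_mul l)
        refine HasDerivAt.congr_deriv e3 ?_
        simp only [Pi.sub_apply]
        field_simp
        push_cast
        ring
      · have d1 : HasDerivAt (fun s : ℝ => y + s * p) p 0 := by
          simpa using ((hasDerivAt_id (0:ℝ)).mul_const p).const_add y
        have d2 : HasDerivAt (fun s : ℝ => z - s * r) (-r) 0 := by
          simpa using ((hasDerivAt_id (0:ℝ)).mul_const r).const_sub z
        have e1 : HasDerivAt (fun s => wx t (y + s * p)) (wxx t y * p) 0 :=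
          HasDerivAt.comp (h₂ := wx t) (0:ℝ) (by simpa using hxx t htI y hyI) d1
        have e2 : HasDerivAt (fun s => wx t (z - s * r)) (wxx t z * -r) 0 :=
          HasDerivAt.comp (h₂ := wx t) (0:ℝ) (by simpa using hxx t htI z hzI) d2
        have e3 := (((e1.mul_const p).add (e2.mul_const r)).sub
          (((((d1.sub d2).mul_const (p + r)).div_const (4 * ρ)).const_sub (p + r)).const_mul K)).sub
          ((((((d1.sub_const x₀).const_mul 2).mul_const p).sub
            (((d2.sub_const x₀).const_mul 2).mul_const r))).const_mul l)
        refine HasDerivAt.congr_deriv e3 ?_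
        field_simp
        ring
    have f1 := abs_le.1 (hF t htI y hyI)
    have f2 := abs_le.1 (hF t htI z hzI)
    have h4 : K * m / ρ ≤ K * (p + r) ^ 2 / (4 * ρ) := by
      rw [div_le_div_iff₀ hρ (by positivity)]
      have : 4 * m ≤ (p + r) ^ 2 := by
        have hpm : √m ≤ p := Real.sqrt_le_sqrt hay.1
        have hrm : √m ≤ r := Real.sqrt_le_sqrt haz.1
        have h2 : 2 * √m ≤ p + r := by linarith
        have h3 := pow_le_pow_left₀ (by positivity) h2 2
        rwa [mul_pow, Real.sq_sqrt hm.le, show (2:ℝ) ^ 2 = 4 by norm_num] at h3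
      have := mul_le_mul_of_nonneg_left this (by positivity : 0 ≤ K * ρ)
      linarith
    have h5 : K * m / ρ = 2 * (K * m / (2 * ρ)) := by field_simp
    rw [hp2, hr2] at hS
    have h6 : l * (a t y + a t z) ≤ l * (2 * M) := mul_le_mul_of_nonneg_left (by linarith) hl0
    linarith [f1.1, f1.2, f2.1, f2.2]
  have := (hmax hq0).trans hle
  simp only [P] at this
  have h7 : 0 ≤ K * ((x - x₀) ^ 2 / (8 * ρ)) := by positivity
  nlinarith [this, h7]

/-- Interior gradient estimate for nondivergence-form parabolic equations in one space
dimension, with no regularity of the coefficient. -/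
theorem gradient_bound (hρ : 0 < ρ) (hm : 0 < m) (hA : 0 ≤ A)
    (hc : ContinuousOn (Function.uncurry w) (Icc (t₀ - ρ ^ 2) t₀ ×ˢ Icc (x₀ - ρ) (x₀ + ρ)))
    (ht : ∀ t ∈ Icc (t₀ - ρ ^ 2) t₀, ∀ x ∈ Icc (x₀ - ρ) (x₀ + ρ),
      HasDerivAt (fun s => w s x) (wt t x) t)
    (hx : ∀ t ∈ Icc (t₀ - ρ ^ 2) t₀, ∀ x ∈ Icc (x₀ - ρ) (x₀ + ρ), HasDerivAt (w t) (wx t x) x)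
    (hxx : ∀ t ∈ Icc (t₀ - ρ ^ 2) t₀, ∀ x ∈ Icc (x₀ - ρ) (x₀ + ρ),
      HasDerivAt (wx t) (wxx t x) x)
    (hwA : ∀ t ∈ Icc (t₀ - ρ ^ 2) t₀, ∀ x ∈ Icc (x₀ - ρ) (x₀ + ρ), |w t x| ≤ A)
    (hF : ∀ t ∈ Icc (t₀ - ρ ^ 2) t₀, ∀ x ∈ Icc (x₀ - ρ) (x₀ + ρ),
      |wt t x - 1 / 2 * a t x * wxx t x| ≤ F)
    (ha : ∀ t ∈ Icc (t₀ - ρ ^ 2) t₀, ∀ x ∈ Icc (x₀ - ρ) (x₀ + ρ), m ≤ a t x ∧ a t x ≤ M) :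
    |wx t₀ x₀| ≤ 2 * ρ / m * (2 * A * (2 * M + 1) / ρ ^ 2 + 2 * F) := by
  have ht0 : t₀ ∈ Icc (t₀ - ρ ^ 2) t₀ := ⟨by nlinarith, le_rfl⟩
  have hx0 : x₀ ∈ Icc (x₀ - ρ) (x₀ + ρ) := ⟨by linarith, by linarith⟩
  have key : ∀ (v : ℝ → ℝ) (v' K : ℝ), HasDerivAt v v' x₀ →
      (∀ x, x₀ ≤ x → x ≤ x₀ + ρ → v x - v x₀ ≤ K * (x - x₀) + 2 * A / ρ ^ 2 * (x - x₀) ^ 2) →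
      v' ≤ K := by
    intro v v' K hv h
    have d : HasDerivAt (fun x => K * (x - x₀) + 2 * A / ρ ^ 2 * (x - x₀) ^ 2 - v x)
        (K - v') x₀ := by
      have := ((((hasDerivAt_id x₀).sub_const x₀).const_mul K).add
        ((((hasDerivAt_id x₀).sub_const x₀).pow 2).const_mul (2 * A / ρ ^ 2))).sub hv
      exact HasDerivAt.congr_deriv this (by simp)
    have h2 := (hasDerivWithinAt_iff_tendsto_slope' (s := Ioi x₀) (by simp)).1
      (d.hasDerivWithinAt (s := Ioi x₀))
    have : 0 ≤ K - v' := by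
      refine ge_of_tendsto h2 ?_
      filter_upwards [Ioc_mem_nhdsGT (show x₀ < x₀ + ρ by linarith)] with y hy
      rw [slope_def_field]
      have := h y hy.1.le hy.2
      exact div_nonneg (by simp; linarith) (by linarith [hy.1])
    linarith
  refine le_of_forall_gt fun K hK => abs_lt.2 ?_
  obtain ⟨K', hK', hKK⟩ := exists_between hK
  constructor
  · have := key (fun x => - w t₀ x) _ K' (hx t₀ ht0 x₀ hx0).neg fun x h1 h2 =>
      doubling_bound (w := fun t x => - w t x) (wt := fun t x => - wt t x)
        (wx := fun t x => - wx t x) (wxx := fun t x => - wxx t x) (a := a) hρ hm hA hc.neg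
        (fun t h x h' => (ht t h x h').neg) (fun t h x h' => (hx t h x h').neg)
        (fun t h x h' => (hxx t h x h').neg) (fun t h x h' => by simpa using hwA t h x h')
        (fun t h x h' => by
          have := hF t h x h'
          rw [← abs_neg] at this
          convert this using 2
          ring) ha hK' h1 h2
    linarith
  · have := key (w t₀) _ K' (hx t₀ ht0 x₀ hx0) fun x h1 h2 =>
      doubling_bound hρ hm hA hc ht hx hxx hwA hF ha hK' h1 h2
    linarith

end DoublingVariables

/-- Smooth functions supported in the closed interval of radius `δ` around `c`. -/
structure IsTest (φ : ℝ → ℝ) (c δ : ℝ) : Prop where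
  smooth : ContDiff ℝ (⊤ : ℕ∞) φ
  zero : ∀ y, δ < |y - c| → φ y = 0

namespace IsTest

variable {φ χ : ℝ → ℝ} {c δ : ℝ}

theorem deriv (h : IsTest φ c δ) : IsTest (deriv φ) c δ where
  smooth := (contDiff_infty_iff_deriv.1 h.smooth).2
  zero y hy := by
    have : φ =ᶠ[nhds y] fun _ => 0 := by
      have hc : ContinuousAt (fun z => |z - c|) y := by fun_prop
      filter_upwards [hc.eventually_const_lt hy] with z hz using h.zero z hz
    simpa using this.deriv_eq

theorem hasDerivAt (h : IsTest φ c δ) (y : ℝ) : HasDerivAt φ (_root_.deriv φ y) y :=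
  (h.smooth.differentiable (by simp)).differentiableAt.hasDerivAt

theorem continuous (h : IsTest φ c δ) : Continuous φ := h.smooth.continuous

theorem mono {c' δ' : ℝ} (h : IsTest φ c δ) (hc : |c - c'| + δ ≤ δ') : IsTest φ c' δ' where
  smooth := h.smooth
  zero y hy := h.zero y (by
    have : |y - c'| ≤ |y - c| + |c - c'| := by
      simpa using abs_add_le (y - c) (c - c')
    linarith)

theorem hasCompactSupport (h : IsTest φ c δ) : HasCompactSupport φ :=
  HasCompactSupport.intro (isCompact_Icc (a := c - δ) (b := c + δ)) fun y hy =>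
    h.zero y (by
      by_contra! hle
      rw [abs_le] at hle
      exact hy ⟨by linarith [hle.1], by linarith [hle.2]⟩)

theorem exists_bound (h : IsTest φ c δ) : ∃ B, 0 ≤ B ∧ ∀ y, |φ y| ≤ B := by
  obtain ⟨B, hB⟩ := h.hasCompactSupport.exists_bound_of_continuous h.continuous
  exact ⟨B, (norm_nonneg _).trans (hB 0), hB⟩

theorem zero_of_notMem (h : IsTest φ c δ) {y : ℝ} (hy : y ∉ Icc (c - δ) (c + δ)) : φ y = 0 :=
  h.zero y (by
    by_contra! hle
    rw [abs_le] at hle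
    exact hy ⟨by linarith [hle.1], by linarith [hle.2]⟩)

theorem integrable_mul (h : IsTest φ c δ) {g : ℝ → ℝ} {M : ℝ} (hg : Measurable g)
    (hM : ∀ y, |y - c| ≤ δ → |g y| ≤ M) : Integrable (fun y => g y * φ y) := by
  obtain ⟨B, hB0, hB⟩ := h.exists_bound
  refine Integrable.mono' (g := (Icc (c - δ) (c + δ)).indicator fun _ => |M| * B) ?_
    (hg.mul h.continuous.measurable).aestronglyMeasurable (Eventually.of_forall fun y => ?_)
  · rw [integrable_indicator_iff measurableSet_Icc]
    exact integrableOn_const (by simp)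
  · by_cases hy : y ∈ Icc (c - δ) (c + δ)
    · rw [indicator_of_mem hy, Real.norm_eq_abs, abs_mul]
      have h1 := hM y (abs_le.2 ⟨by linarith [hy.1], by linarith [hy.2]⟩)
      exact mul_le_mul (h1.trans (le_abs_self M)) (hB y) (abs_nonneg _) (abs_nonneg _)
    · simp [indicator_of_notMem hy, h.zero_of_notMem hy]

theorem integral_deriv (h : IsTest φ c δ) : ∫ y, _root_.deriv φ y = 0 := by
  have := integral_mul_deriv_eq_deriv_mul_of_integrable (u := fun _ => (1:ℝ)) (u' := fun _ => 0)
    (v := φ) (v' := _root_.deriv φ) (fun x _ => hasDerivAt_const x 1)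
    (fun x _ => h.hasDerivAt x) ?_ ?_ ?_
  · simpa using this
  · simpa [Pi.mul_def] using h.deriv.continuous.integrable_of_hasCompactSupport
      h.deriv.hasCompactSupport
  · simp [Pi.mul_def]
  · simpa [Pi.mul_def] using h.continuous.integrable_of_hasCompactSupport h.hasCompactSupport

/-- Integration by parts of a locally Lipschitz function against a test function. -/
theorem integral_mul_deriv (h : IsTest φ c δ) {U : ℝ → ℝ} {C : ℝ}
    (hU : ∀ x y, |x - c| ≤ δ → |y - c| ≤ δ → |U x - U y| ≤ C * |x - y|) :
    ∫ y, U y * _root_.deriv φ y = - ∫ y, _root_.deriv U y * φ y := by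
  rcases lt_or_ge δ 0 with hδ | hδ
  · have h0 : ∀ y, φ y = 0 := fun y => h.zero y (hδ.trans_le (abs_nonneg _))
    have h1 : ∀ y, _root_.deriv φ y = 0 := fun y => h.deriv.zero y (hδ.trans_le (abs_nonneg _))
    simp [h0, h1]
  have hle : c - δ ≤ c + δ := by linarith
  have hmem : ∀ y ∈ Icc (c - δ) (c + δ), |y - c| ≤ δ := fun y hy =>
    abs_le.2 ⟨by linarith [hy.1], by linarith [hy.2]⟩
  -- enlarge the interval, so that the boundary terms vanish, by extending `U`
  have hzero : ∀ χ : ℝ → ℝ, Continuous χ → (∀ y, δ < |y - c| → χ y = 0) →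
      χ (c - δ) = 0 ∧ χ (c + δ) = 0 := by
    intro χ hχ h0
    constructor
    · have : Tendsto χ (nhdsWithin (c - δ) (Iio (c - δ))) (nhds (χ (c - δ))) :=
        hχ.continuousAt.tendsto.mono_left nhdsWithin_le_nhds
      refine tendsto_nhds_unique this (tendsto_const_nhds.congr' ?_)
      filter_upwards [self_mem_nhdsWithin] with y hy
      refine (h0 y ?_).symm
      rw [lt_abs]; right; linarith [mem_Iio.1 hy]
    · have : Tendsto χ (nhdsWithin (c + δ) (Ioi (c + δ))) (nhds (χ (c + δ))) :=
        hχ.continuousAt.tendsto.mono_left nhdsWithin_le_nhds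
      refine tendsto_nhds_unique this (tendsto_const_nhds.congr' ?_)
      filter_upwards [self_mem_nhdsWithin] with y hy
      refine (h0 y ?_).symm
      rw [lt_abs]; left; linarith [mem_Ioi.1 hy]
  have hφ0 := hzero φ h.continuous h.zero
  have hset : ∀ f : ℝ → ℝ, (∀ y, y ∉ Icc (c - δ) (c + δ) → f y = 0) →
      ∫ y, f y = ∫ y in (c - δ)..(c + δ), f y := by
    intro f hf
    rw [intervalIntegral.integral_of_le hle, ← integral_Icc_eq_integral_Ioc,
      setIntegral_eq_integral_of_forall_compl_eq_zero hf]
  rw [hset _ fun y hy => by rw [h.deriv.zero_of_notMem hy, mul_zero],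
    hset _ fun y hy => by rw [h.zero_of_notMem hy, mul_zero]]
  have hacU : AbsolutelyContinuousOnInterval U (c - δ) (c + δ) := by
    refine LipschitzOnWith.absolutelyContinuousOnInterval (K := Real.toNNReal C) ?_
    rw [uIcc_of_le hle]
    refine LipschitzOnWith.of_dist_le_mul fun x hx y hy => ?_
    rw [Real.dist_eq, Real.dist_eq]
    exact (hU x y (hmem x hx) (hmem y hy)).trans
      (mul_le_mul_of_nonneg_right (Real.le_coe_toNNReal C) (abs_nonneg _))
  have hacφ : AbsolutelyContinuousOnInterval φ (c - δ) (c + δ) := by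
    obtain ⟨B, hB0, hB⟩ := h.deriv.exists_bound
    refine LipschitzOnWith.absolutelyContinuousOnInterval (K := Real.toNNReal B) ?_
    exact (lipschitzWith_of_nnnorm_deriv_le (h.smooth.differentiable (by simp)) fun x => by
      rw [← NNReal.coe_le_coe]
      simpa [Real.coe_toNNReal _ hB0] using hB x).lipschitzOnWith
  rw [hacU.integral_mul_deriv_eq_deriv_mul hacφ, hφ0.1, hφ0.2]
  simp

end IsTest

/-- Mollification of `g` at scale `ε` with kernel `κ`. -/
def moll (κ : ℝ → ℝ) (ε : ℝ) (g : ℝ → ℝ) (x : ℝ) : ℝ := ε⁻¹ * ∫ y, g y * κ ((x - y) / ε)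

section Moll

variable {κ χ g h : ℝ → ℝ} {ε x M r : ℝ}

theorem IsTest.comp_mollifier (hκ : IsTest κ 0 1) (hε : 0 < ε) (x : ℝ) :
    IsTest (fun y => κ ((x - y) / ε)) x ε where
  smooth := hκ.smooth.comp (by fun_prop)
  zero y hy := hκ.zero _ (by
    rw [sub_zero, abs_div, abs_of_pos hε, lt_div_iff₀ hε, one_mul, abs_sub_comm]
    exact hy)

theorem deriv_comp_mollifier (hκ : IsTest κ 0 1) (x : ℝ) :
    deriv (fun y => κ ((x - y) / ε)) = fun y => -ε⁻¹ * deriv κ ((x - y) / ε) := by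
  ext y
  have h1 : HasDerivAt (fun y : ℝ => (x - y) / ε) (-1 / ε) y :=
    ((hasDerivAt_id y).const_sub x).div_const ε
  have h2 : HasDerivAt (fun y => κ ((x - y) / ε)) _ y :=
    (hκ.hasDerivAt ((x - y) / ε)).comp y h1
  rw [h2.deriv]; ring

theorem moll_eq (hε : 0 < ε) : moll κ ε g x = ∫ z, g (x - ε * z) * κ z := by
  have h1 := integral_sub_left_eq_self (fun y => g y * κ ((x - y) / ε)) volume x
  have h2 := Measure.integral_comp_mul_left
    (fun y => g (x - y) * κ ((x - (x - y)) / ε)) ε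
  rw [moll, ← h1]
  simp only [sub_sub_cancel] at h2 ⊢
  rw [abs_of_pos (inv_pos.2 hε), smul_eq_mul] at h2
  rw [← h2]
  refine integral_congr_ae (Eventually.of_forall fun z => ?_)
  simp only
  rw [mul_div_cancel_left₀ _ hε.ne']

theorem abs_moll_le {B : ℝ} (hκ : IsTest κ 0 1) (hB : ∀ z, |κ z| ≤ B) (hε : 0 < ε)
    (hg : ∀ y, |y - x| ≤ ε → |g y| ≤ M) : |moll κ ε g x| ≤ 2 * B * M := by
  have hM : 0 ≤ M := (abs_nonneg _).trans (hg x (by simpa using hε.le))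
  rw [moll_eq hε, ← setIntegral_eq_integral_of_forall_compl_eq_zero (s := Icc (-1 : ℝ) 1)]
  · rw [← Real.norm_eq_abs]
    refine (norm_setIntegral_le_of_norm_le_const (μ := volume) (s := Icc (-1 : ℝ) 1) (C := B * M)
      isCompact_Icc.measure_lt_top
      fun z hz => ?_).trans ?_
    · rw [Real.norm_eq_abs, abs_mul, mul_comm]
      refine mul_le_mul (hB z) (hg _ ?_) (abs_nonneg _) ((abs_nonneg _).trans (hB z))
      have : |z| ≤ 1 := abs_le.2 hz
      rw [sub_sub_cancel_left, abs_neg, abs_mul, abs_of_pos hε]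
      nlinarith
    · rw [Measure.real, Real.volume_Icc]
      norm_num
      linarith
  · intro z hz
    rw [hκ.zero_of_notMem (by simpa using hz), mul_zero]

theorem moll_add (hκ : IsTest κ 0 1) (hε : 0 < ε) {M' : ℝ} (hg : Measurable g)
    (hgM : ∀ y, |y - x| ≤ ε → |g y| ≤ M) (hh : Measurable h)
    (hhM : ∀ y, |y - x| ≤ ε → |h y| ≤ M') :
    moll κ ε (fun y => g y + h y) x = moll κ ε g x + moll κ ε h x := by
  simp only [moll, add_mul]
  rw [integral_add ((hκ.comp_mollifier hε x).integrable_mul hg hgM)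
    ((hκ.comp_mollifier hε x).integrable_mul hh hhM), mul_add]

theorem moll_const_mul (a : ℝ) : moll κ ε (fun y => a * g y) x = a * moll κ ε g x := by
  simp only [moll, mul_assoc, integral_const_mul]; ring

theorem moll_kernel_sub (hκ : IsTest κ 0 1) (hχ : IsTest χ 0 1) (hε : 0 < ε) (hg : Measurable g)
    (hgM : ∀ y, |y - x| ≤ ε → |g y| ≤ M) :
    moll (fun z => κ z - χ z) ε g x = moll κ ε g x - moll χ ε g x := by
  simp only [moll, mul_sub]
  rw [integral_sub ((hκ.comp_mollifier hε x).integrable_mul hg hgM)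
    ((hχ.comp_mollifier hε x).integrable_mul hg hgM), mul_sub]

theorem moll_half : moll κ (ε / 2) g x = moll (fun z => 2 * κ (2 * z)) ε g x := by
  simp only [moll]
  have : ∀ y, g y * (2 * κ (2 * ((x - y) / ε))) = 2 * (g y * κ ((x - y) / (ε / 2))) := by
    intro y
    rw [show 2 * ((x - y) / ε) = (x - y) / (ε / 2) by rw [div_div_eq_mul_div]; ring]
    ring
  simp only [this, integral_const_mul]
  rw [inv_div]; ring

theorem moll_const (hε : 0 < ε) (a : ℝ) : moll κ ε (fun _ => a) x = a * ∫ z, κ z := by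
  rw [moll_eq hε, integral_const_mul]

theorem moll_deriv_const (hκ : IsTest κ 0 1) (hε : 0 < ε) (a : ℝ) :
    moll (deriv κ) ε (fun _ => a) x = 0 := by
  rw [moll_const hε, hκ.integral_deriv, mul_zero]

/-- Mollification with a mean zero kernel only sees oscillation. -/
theorem moll_deriv_sub_const (hκ : IsTest κ 0 1) (hε : 0 < ε) (hg : Measurable g)
    (hgM : ∀ y, |y - x| ≤ ε → |g y| ≤ M) (a : ℝ) :
    moll (deriv κ) ε (fun y => g y - a) x = moll (deriv κ) ε g x := by
  simp only [sub_eq_add_neg]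
  rw [moll_add hκ.deriv hε hg hgM measurable_const (M' := |-a|) (fun _ _ => le_rfl),
    moll_deriv_const hκ hε, add_zero]

theorem abs_moll_deriv_le {B : ℝ} (hκ : IsTest κ 0 1) (hB : ∀ z, |deriv κ z| ≤ B) (hε : 0 < ε)
    (hg : Measurable g) {N : ℝ} (hgM : ∀ y, |y - x| ≤ ε → |g y| ≤ M)
    (hN : ∀ y, |y - x| ≤ ε → |g y - g x| ≤ N) : |moll (deriv κ) ε g x| ≤ 2 * B * N := by
  rw [← moll_deriv_sub_const hκ hε hg hgM (g x)]
  exact abs_moll_le hκ.deriv hB hε hN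

theorem hasDerivAt_moll (hκ : IsTest κ 0 1) (hε : 0 < ε) (hεr : ε < r) (hg : Measurable g)
    (hgM : ∀ y, |y - x| ≤ r → |g y| ≤ M) :
    HasDerivAt (moll κ ε g) (ε⁻¹ * moll (deriv κ) ε g x) x := by
  obtain ⟨B, hB0, hB⟩ := hκ.deriv.exists_bound
  have hd : ∀ y x', HasDerivAt (fun x' => g y * κ ((x' - y) / ε))
      (ε⁻¹ * (g y * deriv κ ((x' - y) / ε))) x' := by
    intro y x'
    have h1 : HasDerivAt (fun x' : ℝ => (x' - y) / ε) (1 / ε) x' :=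
      ((hasDerivAt_id x').sub_const y).div_const ε
    have h2 : HasDerivAt (fun x' => κ ((x' - y) / ε)) _ x' :=
      (hκ.hasDerivAt ((x' - y) / ε)).comp x' h1
    exact (h2.const_mul (g y)).congr_deriv (by ring)
  have key := (hasDerivAt_integral_of_dominated_loc_of_deriv_le (μ := volume) (x₀ := x)
    (s := Metric.ball x (r - ε)) (F := fun x' y => g y * κ ((x' - y) / ε))
    (F' := fun x' y => ε⁻¹ * (g y * deriv κ ((x' - y) / ε)))
    (bound := (Icc (x - r) (x + r)).indicator fun _ => ε⁻¹ * (|M| * B))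
    (Metric.ball_mem_nhds x (by linarith)) ?_ ?_ ?_ ?_ ?_ ?_).2
  · have := key.const_mul ε⁻¹
    rw [integral_const_mul] at this
    exact this
  · exact Eventually.of_forall fun x' =>
      (hg.mul ((hκ.comp_mollifier hε x').continuous.measurable)).aestronglyMeasurable
  · exact (hκ.comp_mollifier hε x).integrable_mul hg fun y hy => hgM y (by linarith)
  · exact ((hg.mul ((hκ.deriv.comp_mollifier hε x).continuous.measurable)).const_mul
      ε⁻¹).aestronglyMeasurable
  · refine Eventually.of_forall fun y x' hx' => ?_
    rw [Metric.mem_ball, Real.dist_eq] at hx'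
    by_cases hy : y ∈ Icc (x - r) (x + r)
    · rw [indicator_of_mem hy, Real.norm_eq_abs, abs_mul, abs_mul, abs_of_pos (inv_pos.2 hε)]
      have h1 := hgM y (abs_le.2 ⟨by linarith [hy.1], by linarith [hy.2]⟩)
      exact mul_le_mul_of_nonneg_left (mul_le_mul (h1.trans (le_abs_self M)) (hB _)
        (abs_nonneg _) (abs_nonneg _)) (inv_pos.2 hε).le
    · rw [indicator_of_notMem hy, (hκ.deriv.comp_mollifier hε x').zero y ?_]
      · simp
      · have h1 : r < |y - x| := by
          by_contra! hle
          rw [abs_le] at hle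
          exact hy ⟨by linarith [hle.1], by linarith [hle.2]⟩
        have h2 : |y - x| ≤ |y - x'| + |x' - x| := by simpa using abs_add_le (y - x') (x' - x)
        linarith
  · rw [integrable_indicator_iff measurableSet_Icc]
    exact integrableOn_const (by simp)
  · exact Eventually.of_forall fun y x' _ => hd y x'

theorem moll_deriv_eq {C : ℝ} (hκ : IsTest κ 0 1) (hε : 0 < ε)
    (hg : ∀ y z, |y - x| ≤ ε → |z - x| ≤ ε → |g y - g z| ≤ C * |y - z|) :
    moll (deriv κ) ε g x = ε * moll κ ε (deriv g) x := by
  have h := (hκ.comp_mollifier hε x).integral_mul_deriv hg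
  rw [deriv_comp_mollifier hκ] at h
  have e : ∀ y, g y * (-ε⁻¹ * deriv κ ((x - y) / ε))
      = -ε⁻¹ * (g y * deriv κ ((x - y) / ε)) := fun y => by ring
  simp only [e, integral_const_mul] at h
  simp only [moll]
  rw [← mul_assoc, mul_inv_cancel₀ hε.ne', one_mul]
  linarith

theorem abs_moll_sub_le {B N : ℝ} (hκ : IsTest κ 0 1) (h1 : ∫ z, κ z = 1)
    (hB : ∀ z, |κ z| ≤ B) (hε : 0 < ε) (hg : Measurable g)
    (hgM : ∀ y, |y - x| ≤ ε → |g y| ≤ M) (hN : ∀ y, |y - x| ≤ ε → |g y - g x| ≤ N) :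
    |moll κ ε g x - g x| ≤ 2 * B * N := by
  have : moll κ ε (fun y => g y - g x) x = moll κ ε g x - g x := by
    simp only [sub_eq_add_neg]
    rw [moll_add hκ hε hg hgM measurable_const (M' := |-g x|) (fun _ _ => le_rfl), moll_const hε,
      h1, mul_one]
  rw [← this]
  exact abs_moll_le hκ hB hε hN

end Moll

/-- Quantitative boundedness and Hölder continuity on the interval of radius `δ` around `c`.
For `α = 0` the second condition only says that the oscillation is bounded. -/
structure HolderNear (g : ℝ → ℝ) (c δ C α : ℝ) : Prop where
  meas : Measurable g
  bound : ∀ x, |x - c| ≤ δ → |g x| ≤ C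
  holder : ∀ x y, |x - c| ≤ δ → |y - c| ≤ δ → |g x - g y| ≤ C * |x - y| ^ α

namespace HolderNear

variable {g h : ℝ → ℝ} {c δ C α x y ε : ℝ}

theorem nonneg (hg : HolderNear g c δ C α) (hδ : 0 ≤ δ) : 0 ≤ C :=
  (abs_nonneg _).trans (hg.bound c (by simpa using hδ))

theorem mono {c' δ' C' : ℝ} (hg : HolderNear g c δ C α) (hc : |c' - c| + δ' ≤ δ) (hC : C ≤ C') :
    HolderNear g c' δ' C' α := by
  have hmem : ∀ x, |x - c'| ≤ δ' → |x - c| ≤ δ := fun x hx => by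
    have : |x - c| ≤ |x - c'| + |c' - c| := by simpa using abs_add_le (x - c') (c' - c)
    linarith
  exact ⟨hg.meas, fun x hx => (hg.bound x (hmem x hx)).trans hC, fun x y hx hy =>
    (hg.holder x y (hmem x hx) (hmem y hy)).trans
      (mul_le_mul_of_nonneg_right hC (Real.rpow_nonneg (abs_nonneg _) _))⟩

theorem osc_le (hg : HolderNear g c δ C α) (hα : 0 ≤ α) (hx : |x - c| + ε ≤ δ)
    (hy : |y - x| ≤ ε) : |g y - g x| ≤ C * ε ^ α := by
  have hε : 0 ≤ ε := (abs_nonneg _).trans hy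
  have h1 : |y - c| ≤ |y - x| + |x - c| := by simpa using abs_add_le (y - x) (x - c)
  refine (hg.holder y x (by linarith) (by linarith)).trans ?_
  exact mul_le_mul_of_nonneg_left (Real.rpow_le_rpow (abs_nonneg _) hy hα)
    (hg.nonneg ((abs_nonneg _).trans (by linarith)))

theorem bound_of_near (hg : HolderNear g c δ C α) (hx : |x - c| + ε ≤ δ)
    (hy : |y - x| ≤ ε) : |g y| ≤ C := by
  have h1 : |y - c| ≤ |y - x| + |x - c| := by simpa using abs_add_le (y - x) (x - c)
  exact hg.bound y (by linarith)

theorem abs_moll_deriv_le {κ : ℝ → ℝ} {B : ℝ} (hg : HolderNear g c δ C α) (hα : 0 ≤ α)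
    (hκ : IsTest κ 0 1) (hB : ∀ z, |deriv κ z| ≤ B) (hε : 0 < ε) (hx : |x - c| + ε ≤ δ) :
    |moll (deriv κ) ε g x| ≤ 2 * B * (C * ε ^ α) :=
  _root_.abs_moll_deriv_le hκ hB hε hg.meas (fun _ hy => hg.bound_of_near hx hy)
    fun _ hy => hg.osc_le hα hx hy

end HolderNear

section Smoothing

variable {u v G : ℝ → ℝ → ℝ} {κ : ℝ → ℝ} {s₀ x₀ δ m M C B α : ℝ}

/-- The differential operator applied to a mollified solution, with coefficients frozen. -/
theorem abs_moll_equation_le {U V H : ℝ → ℝ} (hα : 0 ≤ α) (hU : HolderNear U x₀ δ C 1)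
    (hU' : HolderNear (deriv U) x₀ δ C α) (hV : HolderNear V x₀ δ C α)
    (hH : HolderNear H x₀ δ C α) (hκ : IsTest κ 0 1) (hB2 : ∀ z, |deriv (deriv κ) z| ≤ B)
    (hB3 : ∀ z, |deriv (deriv (deriv κ)) z| ≤ B) {ε x : ℝ} (hε : 0 < ε) (hx : |x - x₀| + ε ≤ δ) :
    |(ε⁻¹ ^ 2 * moll (deriv (deriv (deriv κ))) ε (fun y => 1 / 2 * (U y * V y)) x
        + ε⁻¹ * moll (deriv (deriv κ)) ε H x)
      - 1 / 2 * U x * (ε⁻¹ * (ε⁻¹ * moll (deriv (deriv (deriv κ))) ε V x))|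
      ≤ (2 * B * C ^ 2 + 2 * B * C) * (ε ^ α * ε⁻¹) := by
  have hx0 : |x - x₀| ≤ δ := by linarith
  have hδ : 0 ≤ δ := (abs_nonneg _).trans hx0
  have hC : 0 ≤ C := hU.nonneg hδ
  have hB : 0 ≤ B := (abs_nonneg _).trans (hB2 0)
  have hpow : 0 ≤ ε ^ α := Real.rpow_nonneg hε.le _
  set κ3 := deriv (deriv (deriv κ))
  have hκ3 : IsTest κ3 0 1 := hκ.deriv.deriv.deriv
  have bU : ∀ y, |y - x| ≤ ε → |U y| ≤ C := fun y hy => hU.bound_of_near hx hy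
  have bV : ∀ y, |y - x| ≤ ε → |V y| ≤ C := fun y hy => hV.bound_of_near hx hy
  have oU : ∀ y, |y - x| ≤ ε → |U y - U x| ≤ C * ε := fun y hy => by
    simpa using hU.osc_le zero_le_one hx hy
  have oV : ∀ y, |y - x| ≤ ε → |V y - V x| ≤ C * ε ^ α := fun y hy => hV.osc_le hα hx hy
  -- the product of the two oscillations
  have e1 : moll κ3 ε (fun y => (U y - U x) * (V y - V x)) x
      = moll κ3 ε (fun y => U y * V y) x - U x * moll κ3 ε V x - V x * moll κ3 ε U x := by
    have m1 : Measurable fun y => U y * V y := hU.meas.mul hV.meas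
    have m2 : Measurable fun y => -U x * V y := hV.meas.const_mul _
    have m3 : Measurable fun y => -V x * U y := hU.meas.const_mul _
    have b1 : ∀ y, |y - x| ≤ ε → |U y * V y| ≤ C * C := fun y hy => by
      rw [abs_mul]; exact mul_le_mul (bU y hy) (bV y hy) (abs_nonneg _) hC
    have b2 : ∀ y, |y - x| ≤ ε → |-U x * V y| ≤ |-U x| * C := fun y hy => by
      rw [abs_mul]; exact mul_le_mul_of_nonneg_left (bV y hy) (abs_nonneg _)
    have b3 : ∀ y, |y - x| ≤ ε → |-V x * U y| ≤ |-V x| * C := fun y hy => by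
      rw [abs_mul]; exact mul_le_mul_of_nonneg_left (bU y hy) (abs_nonneg _)
    have b12 : ∀ y, |y - x| ≤ ε → |U y * V y + -U x * V y| ≤ C * C + |-U x| * C := fun y hy =>
      (abs_add_le _ _).trans (add_le_add (b1 y hy) (b2 y hy))
    have b123 : ∀ y, |y - x| ≤ ε → |U y * V y + -U x * V y + -V x * U y|
        ≤ C * C + |-U x| * C + |-V x| * C := fun y hy =>
      (abs_add_le _ _).trans (add_le_add (b12 y hy) (b3 y hy))
    have m12 : Measurable fun y => U y * V y + -U x * V y := m1.add m2
    have m123 : Measurable fun y => U y * V y + -U x * V y + -V x * U y := m12.add m3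
    have : (fun y => (U y - U x) * (V y - V x))
        = fun y => (U y * V y + -U x * V y + -V x * U y) + U x * V x := by ext y; ring
    rw [this, moll_add hκ3 hε m123 b123 measurable_const (M' := |U x * V x|)
      (fun _ _ => le_rfl), moll_deriv_const hκ.deriv.deriv hε, moll_add hκ3 hε m12 b12 m3 b3,
      moll_add hκ3 hε m1 b1 m2 b2, moll_const_mul, moll_const_mul]
    ring
  have h1 : |moll κ3 ε (fun y => (U y - U x) * (V y - V x)) x|
      ≤ 2 * B * ((C * ε) * (C * ε ^ α)) := by
    refine abs_moll_le hκ3 hB3 hε fun y hy => ?_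
    rw [abs_mul]
    exact mul_le_mul (oU y hy) (oV y hy) (abs_nonneg _) (by positivity)
  have e2 : moll κ3 ε U x = ε * moll (deriv (deriv κ)) ε (deriv U) x :=
    moll_deriv_eq hκ.deriv.deriv hε fun y z hy hz => by
      have h1 : |y - x₀| ≤ |y - x| + |x - x₀| := by simpa using abs_add_le (y - x) (x - x₀)
      have h2 : |z - x₀| ≤ |z - x| + |x - x₀| := by simpa using abs_add_le (z - x) (x - x₀)
      simpa using hU.holder y z (by linarith) (by linarith)
  have h2 : |moll (deriv (deriv κ)) ε (deriv U) x| ≤ 2 * B * (C * ε ^ α) :=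
    hU'.abs_moll_deriv_le hα hκ.deriv hB2 hε hx
  have h3 : |moll (deriv (deriv κ)) ε H x| ≤ 2 * B * (C * ε ^ α) :=
    hH.abs_moll_deriv_le hα hκ.deriv hB2 hε hx
  have h4 : |V x| ≤ C := bV x (by simpa using hε.le)
  rw [moll_const_mul]
  have e3 : (ε⁻¹ ^ 2 * (1 / 2 * moll κ3 ε (fun y => U y * V y) x)
        + ε⁻¹ * moll (deriv (deriv κ)) ε H x) - 1 / 2 * U x * (ε⁻¹ * (ε⁻¹ * moll κ3 ε V x))
      = 1 / 2 * ε⁻¹ ^ 2 * moll κ3 ε (fun y => (U y - U x) * (V y - V x)) x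
        + 1 / 2 * ε⁻¹ * (V x * moll (deriv (deriv κ)) ε (deriv U) x)
        + ε⁻¹ * moll (deriv (deriv κ)) ε H x := by
    rw [e1, e2]; field_simp; ring
  rw [e3]
  have hi : 0 < ε⁻¹ := inv_pos.2 hε
  refine (abs_add_three _ _ _).trans ?_
  have t1 : |1 / 2 * ε⁻¹ ^ 2 * moll κ3 ε (fun y => (U y - U x) * (V y - V x)) x|
      ≤ 1 / 2 * ε⁻¹ ^ 2 * (2 * B * ((C * ε) * (C * ε ^ α))) := by
    rw [abs_mul, abs_of_pos (by positivity)]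
    exact mul_le_mul_of_nonneg_left h1 (by positivity)
  have t2 : |1 / 2 * ε⁻¹ * (V x * moll (deriv (deriv κ)) ε (deriv U) x)|
      ≤ 1 / 2 * ε⁻¹ * (C * (2 * B * (C * ε ^ α))) := by
    rw [abs_mul, abs_of_pos (by positivity), abs_mul]
    exact mul_le_mul_of_nonneg_left (mul_le_mul h4 h2 (abs_nonneg _) hC) (by positivity)
  have t3 : |ε⁻¹ * moll (deriv (deriv κ)) ε H x| ≤ ε⁻¹ * (2 * B * (C * ε ^ α)) := by
    rw [abs_mul, abs_of_pos hi]
    exact mul_le_mul_of_nonneg_left h3 hi.le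
  refine (add_le_add_three t1 t2 t3).trans (le_of_eq ?_)
  field_simp
  ring

theorem moll_smoothing (hδ : 0 < δ) (hm : 0 < m) (hα : 0 ≤ α)
    (hum : ∀ t, |t - s₀| < δ → ∀ x, |x - x₀| ≤ δ → m ≤ u t x ∧ u t x ≤ M)
    (hu : ∀ t, |t - s₀| < δ → HolderNear (u t) x₀ δ C 1)
    (hu' : ∀ t, |t - s₀| < δ → HolderNear (deriv (u t)) x₀ δ C α)
    (hv : ∀ t, |t - s₀| < δ → HolderNear (v t) x₀ δ C α)
    (hG : ∀ t, |t - s₀| < δ → HolderNear (G t) x₀ δ C α)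
    (hE : ∀ t, |t - s₀| < δ → ∀ φ, IsTest φ x₀ δ → HasDerivAt (fun s => ∫ y, v s y * φ y)
      (∫ y, (1 / 2 * (u t y * v t y) * deriv (deriv φ) y - G t y * deriv φ y)) t)
    (hκ : IsTest κ 0 1) :
    ∃ K, 0 ≤ K ∧ ∀ ε t x, 0 < ε → ε ≤ 1 → √ε ≤ δ / 8 → |t - s₀| ≤ δ / 2 → |x - x₀| ≤ δ / 2 →
      |moll (deriv (deriv κ)) ε (v t) x| ≤ K * (√ε * ε ^ α) := by
  obtain ⟨B₁, hB₁0, hB₁⟩ := hκ.deriv.exists_bound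
  obtain ⟨B₂, hB₂0, hB₂⟩ := hκ.deriv.deriv.exists_bound
  obtain ⟨B₃, hB₃0, hB₃⟩ := hκ.deriv.deriv.deriv.exists_bound
  set B := B₁ + B₂ + B₃
  have hB0 : 0 ≤ B := by positivity
  have hC : 0 ≤ C := (hv s₀ (by simpa using hδ)).nonneg hδ.le
  have hM : 0 ≤ M := by
    have := hum s₀ (by simpa using hδ) x₀ (by simpa using hδ.le); linarith
  refine ⟨2 / m * (4 * B * C * (2 * M + 1) + 4 * B * C ^ 2 + 4 * B * C), by positivity, ?_⟩
  intro ε t x hε hε1 hεδ ht hx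
  have hi : 0 < ε⁻¹ := inv_pos.2 hε
  have hs0 : 0 < √ε := Real.sqrt_pos.2 hε
  have hsq : √ε ^ 2 = ε := Real.sq_sqrt hε.le
  have hεs : ε ≤ √ε := by
    have : √ε ≤ 1 := Real.sqrt_le_one.2 hε1
    nlinarith
  have hT : ∀ s ∈ Icc (t - √ε ^ 2) t, |s - s₀| < δ := by
    intro s hs
    rw [hsq] at hs
    rw [abs_le] at ht
    rw [abs_lt]
    constructor <;> linarith [hs.1, hs.2, ht.1, ht.2]
  have hX : ∀ y ∈ Icc (x - √ε) (x + √ε), |y - x₀| ≤ δ * (5 / 8) := by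
    intro y hy
    rw [abs_le] at hx ⊢
    constructor <;> linarith [hy.1, hy.2, hx.1, hx.2]
  have hd : ∀ χ, IsTest χ 0 1 → ∀ s ∈ Icc (t - √ε ^ 2) t, ∀ y ∈ Icc (x - √ε) (x + √ε),
      HasDerivAt (moll χ ε (v s)) (ε⁻¹ * moll (deriv χ) ε (v s) y) y := fun χ hχ s hs y hy =>
    hasDerivAt_moll hχ hε (r := δ / 4) (by linarith) (hv s (hT s hs)).meas fun z hz =>
      (hv s (hT s hs)).bound_of_near (by linarith [hX y hy]) hz
  have hwt : ∀ s ∈ Icc (t - √ε ^ 2) t, ∀ y ∈ Icc (x - √ε) (x + √ε),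
      HasDerivAt (fun s => moll (deriv κ) ε (v s) y)
        (ε⁻¹ ^ 2 * moll (deriv (deriv (deriv κ))) ε (fun z => 1 / 2 * (u s z * v s z)) y
        + ε⁻¹ * moll (deriv (deriv κ)) ε (G s) y) s := by
    intro s hs y hy
    have hyε : |y - x₀| + ε ≤ δ := by linarith [hX y hy]
    have hφ := hκ.deriv.comp_mollifier hε y
    have h := (hE s (hT s hs) _ (hφ.mono hyε)).const_mul ε⁻¹
    refine h.congr_deriv ?_
    have d1 := deriv_comp_mollifier (ε := ε) hκ.deriv y
    have d2 : deriv (fun z => -ε⁻¹ * deriv (deriv κ) ((y - z) / ε))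
        = fun z => ε⁻¹ ^ 2 * deriv (deriv (deriv κ)) ((y - z) / ε) := by
      ext z
      rw [deriv_const_mul_field, deriv_comp_mollifier hκ.deriv.deriv y]
      ring
    rw [d1, d2]
    have hus := hu s (hT s hs)
    have hvs := hv s (hT s hs)
    have hGs := hG s (hT s hs)
    have i1 := ((hκ.deriv.deriv.deriv.comp_mollifier hε y).mono hyε).integrable_mul
      (g := fun z => 1 / 2 * (u s z * v s z)) (M := 1 / 2 * (C * C))
      ((hus.meas.mul hvs.meas).const_mul _) fun z hz => by
        rw [abs_mul, abs_mul, abs_of_pos (by norm_num : (0:ℝ) < 1 / 2)]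
        exact mul_le_mul_of_nonneg_left (mul_le_mul (hus.bound z hz) (hvs.bound z hz)
          (abs_nonneg _) hC) (by norm_num)
    have i2 := ((hκ.deriv.deriv.comp_mollifier hε y).mono hyε).integrable_mul hGs.meas hGs.bound
    have e : ∀ z, 1 / 2 * (u s z * v s z) * (ε⁻¹ ^ 2 * deriv (deriv (deriv κ)) ((y - z) / ε))
        - G s z * (-ε⁻¹ * deriv (deriv κ) ((y - z) / ε))
        = ε⁻¹ ^ 2 * (1 / 2 * (u s z * v s z) * deriv (deriv (deriv κ)) ((y - z) / ε))
        + ε⁻¹ * (G s z * deriv (deriv κ) ((y - z) / ε)) := fun z => by ring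
    simp only [e]
    rw [integral_add (i1.const_mul _) (i2.const_mul _), integral_const_mul, integral_const_mul]
    simp only [moll]
    ring
  have hbase : ∀ s ∈ Icc (t - √ε ^ 2) t, ∀ y ∈ Icc (x - √ε) (x + √ε),
      |moll (deriv κ) ε (v s) y| ≤ 2 * B * (C * ε ^ α) := fun s hs y hy =>
    (hv s (hT s hs)).abs_moll_deriv_le hα hκ (fun z => (hB₁ z).trans (by linarith)) hε
      (by linarith [hX y hy])
  have hcont : ContinuousOn (Function.uncurry fun s y => moll (deriv κ) ε (v s) y)
      (Icc (t - √ε ^ 2) t ×ˢ Icc (x - √ε) (x + √ε)) := by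
    refine continuousOn_prod_of_continuousOn_lipschitzOnWith' _
      (Real.toNNReal (ε⁻¹ * (2 * B * C))) (fun s hs => ?_) fun y hy s hs =>
        (hwt s hs y hy).continuousAt.continuousWithinAt
    refine Convex.lipschitzOnWith_of_nnnorm_hasDerivWithin_le (convex_Icc _ _)
      (fun y hy => (hd _ hκ.deriv s hs y hy).hasDerivWithinAt) fun y hy => ?_
    rw [← NNReal.coe_le_coe, coe_nnnorm, Real.coe_toNNReal _ (by positivity), Real.norm_eq_abs,
      abs_mul, abs_of_pos hi]
    exact mul_le_mul_of_nonneg_left (abs_moll_le hκ.deriv.deriv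
      (fun z => (hB₂ z).trans (by linarith)) hε fun z hz =>
        (hv s (hT s hs)).bound_of_near (by linarith [hX y hy]) hz) hi.le
  have key := gradient_bound (a := u) (m := m) (M := M)
    (F := (2 * B * C ^ 2 + 2 * B * C) * (ε ^ α * ε⁻¹)) hs0 hm
    (by have := Real.rpow_nonneg hε.le α; positivity) hcont hwt (hd _ hκ.deriv)
    (fun s hs y hy => (hd _ hκ.deriv.deriv s hs y hy).const_mul ε⁻¹) hbase
    (fun s hs y hy => abs_moll_equation_le hα (hu s (hT s hs)) (hu' s (hT s hs)) (hv s (hT s hs))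
      (hG s (hT s hs)) hκ (fun z => (hB₂ z).trans (by linarith))
      (fun z => (hB₃ z).trans (by linarith)) hε (by linarith [hX y hy]))
    (fun s hs y hy => hum s (hT s hs) y (by linarith [hX y hy]))
  rw [abs_mul, abs_of_pos hi, hsq, ← div_eq_inv_mul, div_le_iff₀ hε] at key
  refine key.trans (le_of_eq ?_)
  field_simp
  ring

end Smoothing

theorem exists_halving {φ : ℝ → ℝ} (h : IsTest φ 0 1) :
    IsTest (fun z => 2 * φ (2 * z)) 0 1 ∧
      ∃ χ, IsTest χ 0 1 ∧ deriv χ = fun z => 2 * φ (2 * z) - φ z := by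
  have h2 : IsTest (fun z => 2 * φ (2 * z)) 0 1 := by
    refine ⟨contDiff_const.mul (h.smooth.comp (by fun_prop)), fun y hy => ?_⟩
    rw [h.zero (2 * y), mul_zero]
    rw [sub_zero] at hy ⊢
    rw [abs_mul, abs_two]
    linarith
  refine ⟨h2, fun z => (∫ w in (0:ℝ)..(2 * z), φ w) - ∫ w in (0:ℝ)..z, φ w, ?_, ?_⟩
  all_goals
    have hΦ : ∀ z, HasDerivAt (fun z => ∫ w in (0:ℝ)..z, φ w) (φ z) z := fun z =>
      intervalIntegral.integral_hasDerivAt_right (h.continuous.intervalIntegrable _ _)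
        (h.continuous.stronglyMeasurableAtFilter _ _) h.continuous.continuousAt
    have hχ : ∀ z, HasDerivAt (fun z => (∫ w in (0:ℝ)..(2 * z), φ w) - ∫ w in (0:ℝ)..z, φ w)
        (2 * φ (2 * z) - φ z) z := fun z => by
      have h1 : HasDerivAt (fun z : ℝ => 2 * z) 2 z := by simpa using (hasDerivAt_id z).const_mul 2
      have h3 : HasDerivAt (fun z => ∫ w in (0:ℝ)..(2 * z), φ w) _ z := (hΦ (2 * z)).comp z h1
      exact (h3.sub (hΦ z)).congr_deriv (by ring)
  · refine ⟨contDiff_infty_iff_deriv.2 ⟨fun z => (hχ z).differentiableAt, ?_⟩, fun y hy => ?_⟩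
    · rw [funext fun z => (hχ z).deriv]
      exact h2.smooth.sub h.smooth
    · rw [intervalIntegral.integral_interval_sub_left (h.continuous.intervalIntegrable _ _)
        (h.continuous.intervalIntegrable _ _)]
      refine intervalIntegral.integral_zero_ae (Eventually.of_forall fun z hz => h.zero z ?_)
      rw [sub_zero] at hy ⊢
      rw [lt_abs] at hy ⊢
      rcases hy with hy | hy
      · rw [uIoc_of_le (by linarith)] at hz
        left; exact hy.trans hz.1
      · rw [uIoc_of_ge (by linarith)] at hz
        right; linarith [hz.2]
  · exact funext fun z => (hχ z).deriv

section Recovery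

variable {φ χ g U : ℝ → ℝ} {x₀ δ ε₀ α β γ M C D : ℝ}

theorem moll_deriv_half (hφ : IsTest φ 0 1)
    (h : deriv χ = fun z => 2 * φ (2 * z) - φ z) {ε x : ℝ} (hε : 0 < ε) (hg : Measurable g)
    (hgM : ∀ y, |y - x| ≤ ε → |g y| ≤ M) :
    2 * moll (deriv φ) (ε / 2) g x = moll (deriv φ) ε g x + moll (deriv (deriv χ)) ε g x := by
  have h2 := (exists_halving hφ).1
  have e1 : deriv (fun z => 2 * φ (2 * z)) = fun z => 2 * (2 * deriv φ (2 * z)) := by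
    ext z
    have h1 : HasDerivAt (fun z : ℝ => 2 * z) 2 z := by simpa using (hasDerivAt_id z).const_mul 2
    have h3 : HasDerivAt (fun z => φ (2 * z)) _ z := (hφ.hasDerivAt (2 * z)).comp z h1
    rw [(h3.const_mul 2).deriv]; ring
  have e2 : deriv (deriv χ) = fun z => deriv (fun z => 2 * φ (2 * z)) z - deriv φ z := by
    ext z
    rw [h]
    exact ((h2.hasDerivAt z).sub (hφ.hasDerivAt z)).deriv
  rw [e2, moll_kernel_sub h2.deriv hφ.deriv hε hg hgM, e1, moll_half]
  simp only [moll]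
  have : ∀ y, g y * (2 * (2 * deriv φ (2 * ((x - y) / ε))))
    = 2 * (g y * (2 * deriv φ (2 * ((x - y) / ε)))) := fun y => by ring
  simp only [this, integral_const_mul]
  ring

theorem exists_moll_deriv_bound {ι : Type*} {g : ι → ℝ → ℝ} (hφ : IsTest φ 0 1) (hε₀ : 0 < ε₀)
    (hM0 : 0 ≤ M) (hβ0 : 0 < β) (hβ : β < 1) (hg : ∀ i, Measurable (g i))
    (hgM : ∀ i y, |y - x₀| ≤ δ + ε₀ → |g i y| ≤ M)
    (hb : ∀ χ, IsTest χ 0 1 → ∃ D, 0 ≤ D ∧ ∀ i ε x, 0 < ε → ε ≤ ε₀ → |x - x₀| ≤ δ →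
      |moll (deriv (deriv χ)) ε (g i) x| ≤ D * ε ^ β) :
    ∃ K, 0 ≤ K ∧ ∀ i ε x, 0 < ε → ε ≤ ε₀ → |x - x₀| ≤ δ →
      |moll (deriv φ) ε (g i) x| ≤ K * ε ^ β := by
  obtain ⟨χ, hχ, hχφ⟩ := (exists_halving hφ).2
  obtain ⟨D, hD0, hD⟩ := hb χ hχ
  obtain ⟨B, hB0, hB⟩ := hφ.deriv.exists_bound
  have hgM' : ∀ i ε x, ε ≤ ε₀ → |x - x₀| ≤ δ → ∀ y, |y - x| ≤ ε → |g i y| ≤ M := by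
    intro i ε x hε hx y hy
    have h1 : |y - x₀| ≤ |y - x| + |x - x₀| := by simpa using abs_add_le (y - x) (x - x₀)
    exact hgM i y (by linarith)
  have hr : 0 < 2 * (2:ℝ) ^ (-β) - 1 := by
    have : (2:ℝ) ^ (-1 : ℝ) < (2:ℝ) ^ (-β) :=
      Real.rpow_lt_rpow_of_exponent_lt (by norm_num) (by linarith)
    rw [Real.rpow_neg_one] at this
    linarith
  set K := D / (2 * (2:ℝ) ^ (-β) - 1) + 2 * B * M / (ε₀ / 2) ^ β with hK
  have hpow0 : 0 < (ε₀ / 2) ^ β := Real.rpow_pos_of_pos (by positivity) _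
  have hK0 : 0 ≤ K := by positivity
  have hK1 : D ≤ K * (2 * (2:ℝ) ^ (-β) - 1) := by
    rw [← div_le_iff₀ hr, hK]
    have : 0 ≤ 2 * B * M / (ε₀ / 2) ^ β := by positivity
    linarith
  have hK2 : 2 * B * M ≤ K * (ε₀ / 2) ^ β := by
    rw [← div_le_iff₀ hpow0, hK]
    have : 0 ≤ D / (2 * (2:ℝ) ^ (-β) - 1) := by positivity
    linarith
  have base : ∀ i ε x, ε₀ / 2 ≤ ε → ε ≤ ε₀ → |x - x₀| ≤ δ →
      |moll (deriv φ) ε (g i) x| ≤ K * ε ^ β := by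
    intro i ε x h1 h2 hx
    refine (abs_moll_le hφ.deriv hB (by linarith) (hgM' i ε x h2 hx)).trans (hK2.trans ?_)
    exact mul_le_mul_of_nonneg_left (Real.rpow_le_rpow (by positivity) h1 hβ0.le) hK0
  have step : ∀ n : ℕ, ∀ i ε x, ε₀ / 2 ^ (n + 1) ≤ ε → ε ≤ ε₀ → |x - x₀| ≤ δ →
      |moll (deriv φ) ε (g i) x| ≤ K * ε ^ β := by
    intro n
    induction n with
    | zero => simpa using base
    | succ n ih =>
      intro i ε x h1 h2 hx
      rcases le_or_gt (ε₀ / 2) ε with h3 | h3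
      · exact base i ε x h3 h2 hx
      have hε : 0 < ε := lt_of_lt_of_le (by positivity) h1
      have h4 := ih i (2 * ε) x (by
        rw [pow_succ, ← div_div] at h1; linarith) (by linarith) hx
      have h5 := hD i (2 * ε) x (by linarith) (by linarith) hx
      have h6 := moll_deriv_half (g := g i) (ε := 2 * ε) (x := x) hφ hχφ (by linarith) (hg i)
        (hgM' i _ x (by linarith) hx)
      rw [mul_div_cancel_left₀ _ two_ne_zero] at h6
      have h7 : (ε:ℝ) ^ β = (2:ℝ) ^ (-β) * (2 * ε) ^ β := by
        rw [Real.mul_rpow (by norm_num) hε.le, ← mul_assoc, ← Real.rpow_add (by norm_num)]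
        simp
      have h8 : |2 * moll (deriv φ) ε (g i) x| ≤ (K + D) * (2 * ε) ^ β := by
        rw [h6, add_mul]
        exact (abs_add_le _ _).trans (add_le_add h4 h5)
      rw [abs_mul, abs_two] at h8
      have h9 : (K + D) * (2 * ε) ^ β ≤ (K * (2 * (2:ℝ) ^ (-β))) * (2 * ε) ^ β :=
        mul_le_mul_of_nonneg_right (by linarith) (Real.rpow_nonneg (by linarith) _)
      rw [h7]
      linarith
  refine ⟨K, hK0, fun i ε x hε h2 hx => ?_⟩
  obtain ⟨n, hn⟩ := exists_nat_gt (ε₀ / ε)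
  refine step n i ε x ?_ h2 hx
  rw [div_lt_iff₀ hε] at hn
  rw [div_le_iff₀ (by positivity)]
  have : (n:ℝ) ≤ 2 ^ (n + 1) := by
    exact_mod_cast (Nat.lt_two_pow_self.trans_le (Nat.pow_le_pow_right (by norm_num)
      (Nat.le_succ n))).le
  nlinarith

theorem hasDerivAt_of_moll_bound (hφ : IsTest φ 0 1) (h1 : ∫ z, φ z = 1)
    (hχφ : deriv χ = fun z => 2 * φ (2 * z) - φ z) (hα : 0 < α) (hγ : 0 < γ)
    (hU : HolderNear U x₀ (δ + 2 * ε₀) C α)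
    (hb : ∀ ε x, 0 < ε → ε ≤ ε₀ → |x - x₀| ≤ δ →
      |moll (deriv (deriv χ)) ε U x| ≤ D * (ε * ε ^ γ))
    {ε x : ℝ} (hε : 0 < ε) (hεε : ε ≤ ε₀) (hx : |x - x₀| < δ) :
    HasDerivAt U (deriv U x) x ∧
      |ε⁻¹ * moll (deriv φ) ε U x - deriv U x| ≤ D * ε ^ γ / (1 - (2:ℝ) ^ (-γ)) := by
  obtain ⟨B, hB0, hB⟩ := hφ.exists_bound
  have hr1 : (2:ℝ) ^ (-γ) < 1 := Real.rpow_lt_one_of_one_lt_of_neg (by norm_num) (by linarith)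
  have hr0 : 0 < (2:ℝ) ^ (-γ) := Real.rpow_pos_of_pos (by norm_num) _
  set e : ℕ → ℝ := fun n => ε / 2 ^ n with he
  have he0 : ∀ n, 0 < e n := fun n => by simp only [he]; positivity
  have heε : ∀ n, e n ≤ ε := fun n => div_le_self hε.le (one_le_pow₀ (by norm_num))
  have hes : ∀ n, e (n + 1) = e n / 2 := fun n => by simp only [he]; rw [pow_succ, div_div]
  have heγ : ∀ n, e n ^ γ = ε ^ γ * ((2:ℝ) ^ (-γ)) ^ n := fun n => by
    simp only [he]
    rw [Real.div_rpow hε.le (by positivity), Real.rpow_neg (by norm_num), inv_pow, div_eq_mul_inv,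
      ← Real.rpow_natCast, ← Real.rpow_natCast, ← Real.rpow_mul (by norm_num),
      ← Real.rpow_mul (by norm_num), mul_comm γ]
  clear_value e
  have hUb : ∀ n y, |y - x₀| < δ → ∀ z, |z - y| ≤ e n → |U z| ≤ C := fun n y hy z hz =>
    hU.bound_of_near (by linarith [heε n]) hz
  set G : ℕ → ℝ → ℝ := fun n y => (e n)⁻¹ * moll (deriv φ) (e n) U y with hG
  have hstep : ∀ y, |y - x₀| < δ → ∀ n, dist (G n y) (G (n + 1) y)
      ≤ D * ε ^ γ * ((2:ℝ) ^ (-γ)) ^ n := by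
    intro y hy n
    have h2 := moll_deriv_half hφ hχφ (he0 n) hU.meas (hUb n y hy)
    have h3 : G n y - G (n + 1) y = -(e n)⁻¹ * moll (deriv (deriv χ)) (e n) U y := by
      simp only [hG, hes]
      rw [inv_div]
      linear_combination (-(e n)⁻¹) * h2
    rw [Real.dist_eq, h3, abs_mul, abs_neg, abs_of_pos (inv_pos.2 (he0 n)), mul_assoc, ← heγ,
      inv_mul_le_iff₀ (he0 n)]
    refine (hb (e n) y (he0 n) ((heε n).trans hεε) hy.le).trans (le_of_eq (by ring))
  have hlim : ∀ y, |y - x₀| < δ → ∃ l, Tendsto (fun n => G n y) atTop (nhds l) := fun y hy =>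
    cauchySeq_tendsto_of_complete (cauchySeq_of_le_geometric _ _ hr1 (hstep y hy))
  choose! G' hG' using hlim
  have hdist : ∀ y, |y - x₀| < δ → ∀ n, dist (G n y) (G' y)
      ≤ D * ε ^ γ * ((2:ℝ) ^ (-γ)) ^ n / (1 - (2:ℝ) ^ (-γ)) := fun y hy n =>
    dist_le_of_le_geometric_of_tendsto _ _ hr1 (hstep y hy) (hG' y hy) n
  have hopen : IsOpen {y : ℝ | |y - x₀| < δ} := isOpen_lt (by fun_prop) (by fun_prop)
  have hp : Tendsto (fun n : ℕ => D * ε ^ γ * ((2:ℝ) ^ (-γ)) ^ n / (1 - (2:ℝ) ^ (-γ))) atTop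
      (nhds 0) := by
    simpa using ((tendsto_pow_atTop_nhds_zero_of_lt_one hr0.le hr1).const_mul
      (D * ε ^ γ)).div_const (1 - (2:ℝ) ^ (-γ))
  have hunif : TendstoUniformlyOn G G' atTop {y : ℝ | |y - x₀| < δ} := by
    rw [Metric.tendstoUniformlyOn_iff]
    intro η hη
    filter_upwards [hp.eventually_lt_const hη] with n hn y hy
    rw [dist_comm]
    exact (hdist y hy n).trans_lt hn
  have hconv : ∀ y, |y - x₀| < δ → Tendsto (fun n => moll φ (e n) U y) atTop (nhds (U y)) := by
    intro y hy
    rw [tendsto_iff_dist_tendsto_zero]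
    have h0 : Tendsto (fun n => 2 * B * (C * e n ^ α)) atTop (nhds 0) := by
      have h1 : Tendsto e atTop (nhds 0) := by
        have := (tendsto_pow_atTop_nhds_zero_of_lt_one (r := (1/2:ℝ)) (by norm_num)
          (by norm_num)).const_mul ε
        simpa [he, div_eq_mul_inv] using this
      have h2 := (h1.rpow_const (p := α) (Or.inr hα.le)).const_mul C |>.const_mul (2 * B)
      simpa [Real.zero_rpow hα.ne'] using h2
    refine squeeze_zero (fun _ => dist_nonneg) (fun n => ?_) h0
    rw [Real.dist_eq]
    exact abs_moll_sub_le hφ h1 hB (he0 n) hU.meas (hUb n y hy) fun z hz =>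
      hU.osc_le hα.le (by linarith [heε n]) hz
  have hd := hasDerivAt_of_tendstoUniformlyOn hopen hunif
    (f := fun n => moll φ (e n) U) (g := U) (Eventually.of_forall fun n y hy =>
      hasDerivAt_moll hφ (he0 n) (r := 2 * ε₀) (by linarith [heε n]) hU.meas fun z hz =>
        hU.bound_of_near (by linarith [mem_ofPred.1 hy]) hz) hconv hx
  rw [hd.deriv]
  refine ⟨hd, ?_⟩
  have := hdist x hx 0
  rw [Real.dist_eq] at this
  simpa [hG, he] using this

theorem exists_unit_test : ∃ φ, IsTest φ 0 1 ∧ ∫ z, φ z = 1 := by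
  let f : ContDiffBump (0:ℝ) := ⟨1 / 2, 1, by norm_num, by norm_num⟩
  refine ⟨f.normed volume, ⟨f.contDiff_normed, fun y hy => ?_⟩, f.integral_normed⟩
  have : y ∉ Function.support (f.normed volume) := by
    rw [f.support_normed_eq, Metric.mem_ball, Real.dist_eq]
    exact not_lt.2 hy.le
  exact Function.notMem_support.1 this

theorem exists_holderNear_deriv {ι : Type*} {U : ι → ℝ → ℝ} (hδ : 0 < δ) (hε₀ : 0 < ε₀)
    (hC : 0 ≤ C) (hα : 0 < α) (hγ : 0 < γ)
    (hU : ∀ i, HolderNear (U i) x₀ (δ + 2 * ε₀) C α)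
    (hb : ∀ χ, IsTest χ 0 1 → ∃ D, 0 ≤ D ∧ ∀ i ε x, 0 < ε → ε ≤ ε₀ → |x - x₀| ≤ δ →
      |moll (deriv (deriv χ)) ε (U i) x| ≤ D * (ε * ε ^ γ)) :
    ∃ K, ∀ i, (∀ x, |x - x₀| < δ → DifferentiableAt ℝ (U i) x) ∧
      HolderNear (deriv (U i)) x₀ (δ / 2) K γ := by
  obtain ⟨φ, hφ, h1⟩ := exists_unit_test
  obtain ⟨χ, hχ, hχφ⟩ := (exists_halving hφ).2
  obtain ⟨D, hD0, hD⟩ := hb χ hχ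
  obtain ⟨E, hE0, hE⟩ := hb φ hφ
  obtain ⟨B, hB0, hB⟩ := hφ.deriv.exists_bound
  have hr1 : (2:ℝ) ^ (-γ) < 1 := Real.rpow_lt_one_of_one_lt_of_neg (by norm_num) (by linarith)
  have hr : 0 < 1 - (2:ℝ) ^ (-γ) := by linarith
  set D' := D / (1 - (2:ℝ) ^ (-γ)) with hD'
  have hD'0 : 0 ≤ D' := by positivity
  have core : ∀ i ε x, 0 < ε → ε ≤ ε₀ → |x - x₀| < δ → HasDerivAt (U i) (deriv (U i) x) x ∧
      |ε⁻¹ * moll (deriv φ) ε (U i) x - deriv (U i) x| ≤ D' * ε ^ γ := fun i ε x h2 h3 hx => by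
    have := hasDerivAt_of_moll_bound hφ h1 hχφ hα hγ (hU i) (hD i) h2 h3 hx
    rwa [mul_div_right_comm] at this
  have hp0 : 0 < ε₀ ^ γ := Real.rpow_pos_of_pos hε₀ _
  set N := ε₀⁻¹ * (2 * B * C) + D' * ε₀ ^ γ with hN
  have hN0 : 0 ≤ N := by positivity
  have hbound : ∀ i x, |x - x₀| < δ → |deriv (U i) x| ≤ N := by
    intro i x hx
    have h2 := (core i ε₀ x hε₀ le_rfl hx).2
    have h3 : |ε₀⁻¹ * moll (deriv φ) ε₀ (U i) x| ≤ ε₀⁻¹ * (2 * B * C) := by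
      rw [abs_mul, abs_of_pos (inv_pos.2 hε₀)]
      exact mul_le_mul_of_nonneg_left (abs_moll_le hφ.deriv hB hε₀ fun y hy =>
        (hU i).bound_of_near (by linarith) hy) (inv_pos.2 hε₀).le
    have h4 := abs_sub_abs_le_abs_sub (deriv (U i) x) (ε₀⁻¹ * moll (deriv φ) ε₀ (U i) x)
    rw [abs_sub_comm] at h4
    linarith
  have hclose : ∀ i x y, |x - x₀| < δ → |y - x₀| < δ → |x - y| ≤ ε₀ →
      |deriv (U i) x - deriv (U i) y| ≤ (2 * D' + E) * |x - y| ^ γ := by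
    intro i x y hx hy hxy
    rcases eq_or_ne x y with rfl | hne
    · simp only [sub_self, abs_zero]
      positivity
    set ε := |x - y| with hε
    have hε0 : 0 < ε := abs_pos.2 (sub_ne_zero.2 hne)
    have h2 := (core i ε x hε0 hxy hx).2
    have h3 := (core i ε y hε0 hxy hy).2
    have hconv : Convex ℝ {y : ℝ | |y - x₀| < δ} := by
      have : {y : ℝ | |y - x₀| < δ} = Metric.ball x₀ δ := by ext; simp [Real.dist_eq]
      rw [this]; exact convex_ball _ _
    have h4 := hconv.norm_image_sub_le_of_norm_hasDerivWithin_le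
      (f := fun x => ε⁻¹ * moll (deriv φ) ε (U i) x)
      (f' := fun x => ε⁻¹ * (ε⁻¹ * moll (deriv (deriv φ)) ε (U i) x)) (C := ε⁻¹ * (E * ε ^ γ))
      (fun z hz => ((hasDerivAt_moll hφ.deriv hε0 (r := 2 * ε₀) (by linarith) (hU i).meas
        fun w hw => (hU i).bound_of_near (by linarith [mem_ofPred.1 hz]) hw).const_mul
          ε⁻¹).hasDerivWithinAt) (fun z hz => by
        rw [Real.norm_eq_abs, abs_mul, abs_mul, abs_of_pos (inv_pos.2 hε0)]
        refine mul_le_mul_of_nonneg_left ?_ (inv_pos.2 hε0).le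
        rw [inv_mul_le_iff₀ hε0]
        exact (hE i ε z hε0 hxy (le_of_lt hz)).trans (le_of_eq (by ring))) hy hx
    rw [Real.norm_eq_abs, Real.norm_eq_abs, ← hε] at h4
    have h5 : ε⁻¹ * (E * ε ^ γ) * ε = E * ε ^ γ := by field_simp
    rw [h5] at h4
    rw [abs_le] at h2 h3 h4 ⊢
    constructor <;> linarith [h2.1, h2.2, h3.1, h3.2, h4.1, h4.2]
  have hfar : ∀ i x y, |x - x₀| < δ → |y - x₀| < δ → ε₀ < |x - y| →
      |deriv (U i) x - deriv (U i) y| ≤ (2 * N / ε₀ ^ γ) * |x - y| ^ γ := by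
    intro i x y hx hy hxy
    have h2 : |deriv (U i) x - deriv (U i) y| ≤ 2 * N := by
      have := abs_sub (deriv (U i) x) (deriv (U i) y)
      linarith [hbound i x hx, hbound i y hy]
    refine h2.trans ?_
    rw [div_mul_eq_mul_div, le_div_iff₀ hp0]
    exact mul_le_mul_of_nonneg_left (Real.rpow_le_rpow hε₀.le hxy.le hγ.le) (by positivity)
  have hq : 0 ≤ 2 * N / ε₀ ^ γ := by positivity
  refine ⟨N + (2 * D' + E) + 2 * N / ε₀ ^ γ, fun i =>
    ⟨fun x hx => (core i ε₀ x hε₀ le_rfl hx).1.differentiableAt, measurable_deriv _,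
      fun x hx => (hbound i x (by linarith)).trans (by linarith), fun x y hx hy => ?_⟩⟩
  have hpn : 0 ≤ |x - y| ^ γ := Real.rpow_nonneg (abs_nonneg _) _
  rcases le_or_gt |x - y| ε₀ with h | h
  · exact (hclose i x y (by linarith) (by linarith) h).trans
      (mul_le_mul_of_nonneg_right (by linarith) hpn)
  · exact (hfar i x y (by linarith) (by linarith) h).trans
      (mul_le_mul_of_nonneg_right (by linarith) hpn)

end Recovery

section WeakDerivative

variable {κ : ℝ → ℝ}

theorem tendstoUniformlyOn_moll {g : ℝ → ℝ} (hκ : IsTest κ 0 1) (h1 : ∫ z, κ z = 1)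
    (hg : Continuous g) (a b : ℝ) :
    TendstoUniformlyOn (fun ε x => moll κ ε g x) g (nhdsWithin 0 (Ioi 0)) (Icc a b) := by
  obtain ⟨B, hB0, hB⟩ := hκ.exists_bound
  have huc := (isCompact_Icc (a := a - 1) (b := b + 1)).uniformContinuousOn_of_continuous
    hg.continuousOn
  obtain ⟨M, hM⟩ := (isCompact_Icc (a := a - 1) (b := b + 1)).exists_bound_of_continuousOn
    hg.continuousOn
  rw [Metric.uniformContinuousOn_iff] at huc
  rw [Metric.tendstoUniformlyOn_iff]
  intro η hη
  obtain ⟨δ, hδ, h⟩ := huc (η / (4 * (B + 1))) (by positivity)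
  filter_upwards [Ioo_mem_nhdsGT (lt_min hδ one_pos)] with ε hε x hx
  have hε1 : ε < 1 := hε.2.trans_le (min_le_right _ _)
  have hεδ : ε < δ := hε.2.trans_le (min_le_left _ _)
  have hmem : ∀ y, |y - x| ≤ ε → y ∈ Icc (a - 1) (b + 1) := fun y hy => by
    rw [abs_le] at hy
    exact ⟨by linarith [hx.1, hy.1], by linarith [hx.2, hy.2]⟩
  have := abs_moll_sub_le (x := x) hκ h1 hB hε.1 hg.measurable (fun y hy => hM y (hmem y hy))
    (N := η / (4 * (B + 1))) fun y hy =>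
      (h y (hmem y hy) x (hmem x (by simpa using hε.1.le)) (hy.trans_lt hεδ)).le
  rw [dist_comm, Real.dist_eq]
  refine this.trans_lt ?_
  rw [mul_div_assoc', div_lt_iff₀ (by positivity)]
  nlinarith

/-- A continuous function with continuous weak derivative is differentiable. -/
theorem hasDerivAt_of_weak {f B : ℝ → ℝ} {a b t : ℝ} (hf : ContinuousOn f (Ioo a b))
    (hB : ContinuousOn B (Ioo a b))
    (hw : ∀ θ c δ, IsTest θ c δ → Icc (c - δ) (c + δ) ⊆ Ioo a b →
      ∫ s, (f s * deriv θ s + B s * θ s) = 0) (ht : t ∈ Ioo a b) : HasDerivAt f (B t) t := by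
  obtain ⟨κ, hκ, h1⟩ := exists_unit_test
  obtain ⟨r, hr, hrs⟩ : ∃ r, 0 < r ∧ Icc (t - 2 * r) (t + 2 * r) ⊆ Ioo a b := by
    obtain ⟨ε, hε, h⟩ := Metric.isOpen_iff.1 isOpen_Ioo t ht
    refine ⟨ε / 3, by positivity, fun s hs => h ?_⟩
    rw [Metric.mem_ball, Real.dist_eq, abs_lt]
    exact ⟨by linarith [hs.1], by linarith [hs.2]⟩
  have hle : t - 2 * r ≤ t + 2 * r := by linarith
  set p : ℝ → ℝ := fun s => max (t - 2 * r) (min s (t + 2 * r)) with hp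
  have hpm : ∀ s, p s ∈ Ioo a b := fun s =>
    hrs ⟨le_max_left _ _, max_le hle (min_le_right _ _)⟩
  have hpc : Continuous p := by fun_prop
  have hpe : ∀ s ∈ Icc (t - 2 * r) (t + 2 * r), p s = s := fun s hs => by
    simp only [hp]; rw [min_eq_left hs.2, max_eq_right hs.1]
  have hfc : Continuous (f ∘ p) := hf.comp_continuous hpc hpm
  have hBc : Continuous (B ∘ p) := hB.comp_continuous hpc hpm
  obtain ⟨M, hM⟩ := (isCompact_Icc (a := t - 3 * r) (b := t + 3 * r)).exists_bound_of_continuousOn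
    hfc.continuousOn
  obtain ⟨M', hM'⟩ := (isCompact_Icc (a := t - 3 * r) (b := t + 3 * r)).exists_bound_of_continuousOn
    hBc.continuousOn
  have key : ∀ ε, 0 < ε → ε < r → ∀ s ∈ Ioo (t - r) (t + r),
      ε⁻¹ * moll (deriv κ) ε (f ∘ p) s = moll κ ε (B ∘ p) s := by
    intro ε hε hεr s hs
    have hθ := hκ.comp_mollifier hε s
    have hI := hw _ s ε hθ ((Icc_subset_Icc (by linarith [hs.1]) (by linarith [hs.2])).trans hrs)
    have hIcc : ∀ y, |y - s| ≤ ε → y ∈ Icc (t - 2 * r) (t + 2 * r) := fun y hy => by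
      rw [abs_le] at hy
      exact ⟨by linarith [hs.1, hy.1], by linarith [hs.2, hy.2]⟩
    have hIcc' : ∀ y, |y - s| ≤ ε → y ∈ Icc (t - 3 * r) (t + 3 * r) := fun y hy =>
      ⟨by linarith [(hIcc y hy).1], by linarith [(hIcc y hy).2]⟩
    have e1 : ∫ y, (f y * deriv (fun y => κ ((s - y) / ε)) y + B y * κ ((s - y) / ε))
        = ∫ y, ((f ∘ p) y * deriv (fun y => κ ((s - y) / ε)) y + (B ∘ p) y * κ ((s - y) / ε)) := by
      congr 1
      ext y
      by_cases hy : |y - s| ≤ ε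
      · simp only [Function.comp, hpe y (hIcc y hy)]
      · push Not at hy
        rw [hθ.deriv.zero y hy, hθ.zero y hy]; simp
    rw [e1, integral_add (hθ.deriv.integrable_mul hfc.measurable fun y hy => hM y (hIcc' y hy))
      (hθ.integrable_mul hBc.measurable fun y hy => hM' y (hIcc' y hy)),
      deriv_comp_mollifier hκ] at hI
    have e : ∀ y, (f ∘ p) y * (-ε⁻¹ * deriv κ ((s - y) / ε))
      = -ε⁻¹ * ((f ∘ p) y * deriv κ ((s - y) / ε)) := fun y => by ring
    simp only [e, integral_const_mul] at hI
    simp only [moll]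
    linear_combination (-ε⁻¹) * hI
  have hmem : t ∈ Ioo (t - r) (t + r) := ⟨by linarith, by linarith⟩
  have hfin : HasDerivAt (f ∘ p) ((B ∘ p) t) t := by
    refine hasDerivAt_of_tendstoUniformlyOn (l := nhdsWithin (0:ℝ) (Ioi 0))
      (f := fun ε => moll κ ε (f ∘ p)) (f' := fun ε => moll κ ε (B ∘ p)) isOpen_Ioo
      ((tendstoUniformlyOn_moll hκ h1 hBc (t - r) (t + r)).mono Ioo_subset_Icc_self) ?_ ?_ hmem
    · filter_upwards [Ioo_mem_nhdsGT hr] with ε hε s hs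
      rw [← key ε hε.1 hε.2 s hs]
      refine hasDerivAt_moll hκ hε.1 hε.2 hfc.measurable (M := M) fun y hy => hM y ?_
      rw [abs_le] at hy
      exact ⟨by linarith [hs.1, hy.1], by linarith [hs.2, hy.2]⟩
    · intro s hs
      exact (tendstoUniformlyOn_moll hκ h1 hfc (t - r) (t + r)).tendsto_at (Ioo_subset_Icc_self hs)
  have hpt : p t = t := hpe t ⟨by linarith, by linarith⟩
  rw [Function.comp, hpt] at hfin
  refine hfin.congr_of_eventuallyEq ?_
  filter_upwards [Ioo_mem_nhds hmem.1 hmem.2] with s hs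
  rw [Function.comp, hpe s ⟨by linarith [hs.1], by linarith [hs.2]⟩]

end WeakDerivative

/-- A family of measurable functions, locally bounded uniformly in a parameter near `t₀` and
continuous in the parameter at `t₀`. -/
structure NiceAt (g : ℝ → ℝ → ℝ) (t₀ : ℝ) : Prop where
  meas : ∀ t, Measurable (g t)
  bdd : ∀ R, ∃ M, ∀ᶠ t in nhds t₀, ∀ x, |x| ≤ R → |g t x| ≤ M
  cont : ∀ x, ContinuousAt (fun t => g t x) t₀

namespace NiceAt

variable {g h : ℝ → ℝ → ℝ} {t₀ : ℝ}

theorem mul (hg : NiceAt g t₀) (hh : NiceAt h t₀) : NiceAt (fun t x => g t x * h t x) t₀ where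
  meas t := (hg.meas t).mul (hh.meas t)
  bdd R := by
    obtain ⟨M, hM⟩ := hg.bdd R
    obtain ⟨N, hN⟩ := hh.bdd R
    refine ⟨|M| * |N|, ?_⟩
    filter_upwards [hM, hN] with t h1 h2 x hx
    rw [abs_mul]
    exact mul_le_mul ((h1 x hx).trans (le_abs_self M)) ((h2 x hx).trans (le_abs_self N))
      (abs_nonneg _) (abs_nonneg _)
  cont x := (hg.cont x).mul (hh.cont x)

theorem continuousAt_integral {φ : ℝ → ℝ} {c δ : ℝ} (hg : NiceAt g t₀) (hφ : IsTest φ c δ) :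
    ContinuousAt (fun t => ∫ x, g t x * φ x) t₀ := by
  obtain ⟨M, hM⟩ := hg.bdd (|c| + |δ|)
  refine continuousAt_of_dominated (bound := fun x => M * |φ x|)
    (Eventually.of_forall fun t =>
      ((hg.meas t).mul hφ.continuous.measurable).aestronglyMeasurable) ?_ ?_
    (Eventually.of_forall fun x => (hg.cont x).mul continuousAt_const)
  · filter_upwards [hM] with t ht
    refine Eventually.of_forall fun x => ?_
    rw [Real.norm_eq_abs, abs_mul]
    rcases le_or_gt |x - c| δ with hx | hx
    · refine mul_le_mul_of_nonneg_right (ht x ?_) (abs_nonneg _)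
      have : |x| ≤ |x - c| + |c| := by simpa using abs_add_le (x - c) c
      linarith [le_abs_self δ]
    · simp [hφ.zero x hx]
  · exact ((hφ.continuous.integrable_of_hasCompactSupport hφ.hasCompactSupport).abs).const_mul M

end NiceAt

section RegWeak

variable {T : ℝ} {u : ℝ → ℝ → ℝ} {t : ℝ}

theorem RegWeak.continuous (hu : RegWeak T u) (ht : t ∈ Ico 0 T) : Continuous (u t) := by
  rw [continuous_iff_continuousAt]
  intro x
  obtain ⟨L, hL⟩ := hu.2.1 t ht (|x| + 1) (by positivity)
  refine hL.continuousOn.continuousAt (Icc_mem_nhds ?_ ?_)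
  · linarith [neg_abs_le x]
  · linarith [le_abs_self x]

theorem RegWeak.exists_deriv_bound (hu : RegWeak T u) (ht : t ∈ Ico 0 T) (R : ℝ) :
    ∃ L, ∀ x, |x| ≤ R → |deriv (u t) x| ≤ L := by
  obtain ⟨L, hL⟩ := hu.2.1 t ht (|R| + 1) (by positivity)
  refine ⟨L, fun x hx => ?_⟩
  have hx' := abs_le.1 (hx.trans (le_abs_self R))
  refine norm_deriv_le_of_lipschitzOn (Icc_mem_nhds ?_ ?_) hL <;> linarith [hx'.1, hx'.2]

theorem RegWeak.exists_bound (hu : RegWeak T u) (ht : t ∈ Ico 0 T) (R : ℝ) :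
    ∃ L, ∀ x, |x| ≤ R → |u t x| ≤ L := by
  obtain ⟨L, hL⟩ := (isCompact_Icc (a := -R) (b := R)).exists_bound_of_continuousOn
    (hu.continuous ht).continuousOn
  exact ⟨L, fun x hx => hL x (abs_le.1 hx)⟩

theorem RegWeak.ae_differentiableAt (hu : RegWeak T u) (ht : t ∈ Ico 0 T) :
    ∀ᵐ x, DifferentiableAt ℝ (u t) x := by
  have h : ∀ n : ℕ, ∀ᵐ x, x ∈ Icc (-((n:ℝ) + 1)) (n + 1) →
      DifferentiableWithinAt ℝ (u t) (Icc (-((n:ℝ) + 1)) (n + 1)) x := fun n => by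
    obtain ⟨L, hL⟩ := hu.2.1 t ht (n + 1) (by positivity)
    exact hL.ae_differentiableWithinAt_of_mem_real
  filter_upwards [ae_all_iff.2 h] with x hx
  obtain ⟨n, hn⟩ := exists_nat_gt |x|
  rw [abs_lt] at hn
  exact (hx n ⟨by linarith [hn.1], by linarith [hn.2]⟩).differentiableAt
    (Icc_mem_nhds (by linarith [hn.1]) (by linarith [hn.2]))

theorem RegWeak.eventually_close (hu : RegWeak T u) (ht : t ∈ Ioo 0 T) (R : ℝ) {η : ℝ}
    (hη : 0 < η) : ∀ᶠ s in nhds t, s ∈ Ioo 0 T ∧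
      ∀ x, |x| ≤ R → |u s x - u t x| ≤ η ∧ |deriv (u s) x - deriv (u t) x| ≤ η := by
  have ht' := Ioo_subset_Ico_self ht
  have h := hu.2.2 t ht' (|R| + 1) (by positivity)
  have hle : nhds t ≤ nhdsWithin t (Ico 0 T) := by
    rw [nhdsWithin_eq_nhds.2 (Ico_mem_nhds ht.1 ht.2)]
  filter_upwards [Ioo_mem_nhds ht.1 ht.2, (h.mono_left hle).eventually_le_const hη] with s hs hsη
  refine ⟨hs, fun x hx => ?_⟩
  have hs' := Ioo_subset_Ico_self hs
  have hmem : x ∈ Icc (-(|R| + 1)) (|R| + 1) :=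
    abs_le.1 (hx.trans ((le_abs_self R).trans (by linarith)))
  obtain ⟨L₁, h₁⟩ := hu.exists_deriv_bound ht' (|R| + 1)
  obtain ⟨L₂, h₂⟩ := hu.exists_deriv_bound hs' (|R| + 1)
  obtain ⟨L₃, h₃⟩ := hu.exists_bound ht' (|R| + 1)
  obtain ⟨L₄, h₄⟩ := hu.exists_bound hs' (|R| + 1)
  have hb : BddAbove (range fun x : Icc (-(|R| + 1)) (|R| + 1) =>
      (|u s x.1 - u t x.1| + |deriv (u s) x.1 - deriv (u t) x.1|)) := by
    refine ⟨L₄ + L₃ + (L₂ + L₁), ?_⟩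
    rintro _ ⟨⟨y, hy⟩, rfl⟩
    have hy' := abs_le.2 hy
    exact add_le_add ((abs_sub _ _).trans (add_le_add (h₄ y hy') (h₃ y hy')))
      ((abs_sub _ _).trans (add_le_add (h₂ y hy') (h₁ y hy')))
  have := (le_ciSup hb ⟨x, hmem⟩).trans hsη
  simp only at this
  constructor <;> linarith [abs_nonneg (u s x - u t x), abs_nonneg (deriv (u s) x - deriv (u t) x)]

theorem RegWeak.niceAt_indicator (hu : RegWeak T u) (ht : t ∈ Ioo 0 T) :
    NiceAt ((Ioo 0 T).indicator u) t ∧ NiceAt (fun s => deriv (u s)) t := by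
  have ht' := Ioo_subset_Ico_self ht
  have hclose : ∀ x η, 0 < η → ∀ᶠ s in nhds t, s ∈ Ioo 0 T ∧
      |u s x - u t x| ≤ η ∧ |deriv (u s) x - deriv (u t) x| ≤ η := fun x η hη => by
    filter_upwards [hu.eventually_close ht |x| hη] with s hs using ⟨hs.1, hs.2 x le_rfl⟩
  refine ⟨⟨fun s => ?_, fun R => ?_, fun x => ?_⟩, ⟨fun s => measurable_deriv _, fun R => ?_,
    fun x => ?_⟩⟩
  · by_cases hs : s ∈ Ioo 0 T
    · rw [indicator_of_mem hs]
      exact (hu.continuous (Ioo_subset_Ico_self hs)).measurable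
    · rw [indicator_of_notMem hs]
      exact measurable_const
  · obtain ⟨L, hL⟩ := hu.exists_bound ht' R
    refine ⟨L + 1, ?_⟩
    filter_upwards [hu.eventually_close ht R one_pos] with s hs x hx
    rw [indicator_of_mem hs.1]
    have := abs_add_le (u s x - u t x) (u t x)
    rw [sub_add_cancel] at this
    linarith [(hs.2 x hx).1, hL x hx]
  · rw [Metric.continuousAt_iff']
    intro η hη
    filter_upwards [hclose x (η / 2) (by positivity)] with s hs
    rw [indicator_of_mem hs.1, indicator_of_mem ht, Real.dist_eq]
    linarith [hs.2.1]
  · obtain ⟨L, hL⟩ := hu.exists_deriv_bound ht' R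
    refine ⟨L + 1, ?_⟩
    filter_upwards [hu.eventually_close ht R one_pos] with s hs x hx
    have := abs_add_le (deriv (u s) x - deriv (u t) x) (deriv (u t) x)
    rw [sub_add_cancel] at this
    linarith [(hs.2 x hx).2, hL x hx]
  · rw [Metric.continuousAt_iff']
    intro η hη
    filter_upwards [hclose x (η / 2) (by positivity)] with s hs
    rw [Real.dist_eq]
    linarith [hs.2.2]

end RegWeak

section WeakSolution

variable {T : ℝ} {u : ℝ → ℝ → ℝ} {t : ℝ} {φ : ℝ → ℝ} {c δ : ℝ}

theorem RegWeak.integrable (hu : RegWeak T u) (ht : t ∈ Ico 0 T) (hφ : IsTest φ c δ) :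
    Integrable (fun x => u t x * φ x) ∧ Integrable (fun x => u t x * deriv (u t) x * φ x) ∧
      Integrable (fun x => deriv (u t) x * deriv (u t) x * φ x) := by
  obtain ⟨M, hM⟩ := hu.exists_bound ht (|c| + δ)
  obtain ⟨L, hL⟩ := hu.exists_deriv_bound ht (|c| + δ)
  have hx : ∀ y, |y - c| ≤ δ → |y| ≤ |c| + δ := fun y hy => by
    have : |y| ≤ |y - c| + |c| := by simpa using abs_add_le (y - c) c
    linarith
  have hum := (hu.continuous ht).measurable
  have hqm := measurable_deriv (u t)
  refine ⟨hφ.integrable_mul hum fun y hy => hM y (hx y hy),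
    hφ.integrable_mul (M := |M| * |L|) (hum.mul hqm) fun y hy => ?_,
    hφ.integrable_mul (M := |L| * |L|) (hqm.mul hqm) fun y hy => ?_⟩
  · rw [abs_mul]
    exact mul_le_mul ((hM y (hx y hy)).trans (le_abs_self M))
      ((hL y (hx y hy)).trans (le_abs_self L)) (abs_nonneg _) (abs_nonneg _)
  · rw [abs_mul]
    exact mul_le_mul ((hL y (hx y hy)).trans (le_abs_self L))
      ((hL y (hx y hy)).trans (le_abs_self L)) (abs_nonneg _) (abs_nonneg _)

theorem IsWeakSolution.integral_test_eq_zero (hu : IsWeakSolution T u) (hφ : IsTest φ c δ)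
    {θ : ℝ → ℝ} {a r : ℝ} (hθ : IsTest θ a r) (hsub : Icc (a - r) (a + r) ⊆ Ioo 0 T) :
    ∫ s, ((∫ x, u s x * φ x) * deriv θ s + -(1/2) * ((∫ x, u s x * deriv (u s) x * deriv φ x)
      + ∫ x, deriv (u s) x * deriv (u s) x * φ x) * θ s) = 0 := by
  obtain ⟨-, hr, hw⟩ := hu
  have hout : ∀ s, s ∉ Ioo 0 T → θ s = 0 ∧ deriv θ s = 0 := fun s hs =>
    ⟨hθ.zero_of_notMem fun h => hs (hsub h), hθ.deriv.zero_of_notMem fun h => hs (hsub h)⟩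
  have h := hw (fun s x => θ s * φ x) ?_ ?_ ?_
  · rw [(hout 0 (by simp)).1] at h
    simp only [zero_mul, mul_zero, integral_zero, zero_add] at h
    rw [← h, ← setIntegral_eq_integral_of_forall_compl_eq_zero (s := Ico 0 T)]
    · refine setIntegral_congr_fun measurableSet_Ico fun s hs => ?_
      obtain ⟨i1, -, i3⟩ := hr.integrable hs hφ
      obtain ⟨-, i2, -⟩ := hr.integrable hs hφ.deriv
      have e : (fun x => u s x * deriv (fun s => θ s * φ x) s
          - 1 / 2 * deriv (fun y => θ s * φ y * u s y) x * deriv (u s) x)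
          =ᵐ[volume] fun x => deriv θ s * (u s x * φ x)
            - (1 / 2 * θ s) * (u s x * deriv (u s) x * deriv φ x
              + deriv (u s) x * deriv (u s) x * φ x) := by
        filter_upwards [hr.ae_differentiableAt hs] with x hx
        have h1 : deriv (fun s => θ s * φ x) s = deriv θ s * φ x :=
          ((hθ.hasDerivAt s).mul_const (φ x)).deriv
        have h2 : deriv (fun y => θ s * φ y * u s y) x
            = θ s * deriv φ x * u s x + θ s * φ x * deriv (u s) x :=
          (((hφ.hasDerivAt x).const_mul (θ s)).mul hx.hasDerivAt).deriv
        rw [h1, h2]; ring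
      have i4 : Integrable (fun x => 1 / 2 * θ s * (u s x * deriv (u s) x * deriv φ x
          + deriv (u s) x * deriv (u s) x * φ x)) := (i2.add i3).const_mul _
      rw [integral_congr_ae e, integral_sub (i1.const_mul _) i4,
        integral_const_mul, integral_const_mul, integral_add i2 i3]
      ring
    · intro s hs
      have := hout s fun h => hs (Ioo_subset_Ico_self h)
      simp [this.1, this.2]
  · exact (hθ.smooth.comp contDiff_fst).mul (hφ.smooth.comp contDiff_snd)
  · refine HasCompactSupport.intro ((isCompact_Icc (a := a - r) (b := a + r)).prod
      (isCompact_Icc (a := c - δ) (b := c + δ))) fun p hp => ?_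
    rw [mem_prod, not_and_or] at hp
    rcases hp with hp | hp
    · simp [Function.uncurry, hθ.zero_of_notMem hp]
    · simp [Function.uncurry, hφ.zero_of_notMem hp]
  · have hcl : IsClosed (Icc (a - r) (a + r) ×ˢ (univ : Set ℝ)) := isClosed_Icc.prod isClosed_univ
    refine (closure_minimal (fun p hp => ?_) hcl).trans
      (prod_mono (fun s hs => (hsub hs).2) le_rfl)
    by_contra hn
    refine hp ?_
    have : p.1 ∉ Icc (a - r) (a + r) := fun h => hn ⟨h, mem_univ _⟩
    simp [Function.uncurry, hθ.zero_of_notMem this]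

theorem IsWeakSolution.hasDerivAt_integral (hu : IsWeakSolution T u) (ht : t ∈ Ioo 0 T)
    (hφ : IsTest φ c δ) :
    HasDerivAt (fun s => ∫ x, u s x * φ x) (-(1/2) * ((∫ x, u t x * deriv (u t) x * deriv φ x)
      + ∫ x, deriv (u t) x * deriv (u t) x * φ x)) t := by
  refine hasDerivAt_of_weak (a := 0) (b := T) (f := fun s => ∫ x, u s x * φ x)
    (B := fun s => -(1/2) * ((∫ x, u s x * deriv (u s) x * deriv φ x)
      + ∫ x, deriv (u s) x * deriv (u s) x * φ x)) (fun s hs => ?_) (fun s hs => ?_)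
    (fun θ a r hθ hsub => hu.integral_test_eq_zero hφ hθ hsub) ht
  · obtain ⟨h1, -⟩ := hu.2.1.niceAt_indicator hs
    refine ((h1.continuousAt_integral hφ).congr ?_).continuousWithinAt
    filter_upwards [Ioo_mem_nhds hs.1 hs.2] with r hr
    rw [indicator_of_mem hr]
  · obtain ⟨h1, h2⟩ := hu.2.1.niceAt_indicator hs
    have h := (((h1.mul h2).continuousAt_integral hφ.deriv).add
      ((h2.mul h2).continuousAt_integral hφ)).const_mul (-(1/2))
    refine (h.congr ?_).continuousWithinAt
    filter_upwards [Ioo_mem_nhds hs.1 hs.2] with r hr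
    simp only [Pi.add_apply, indicator_of_mem hr]

theorem RegWeak.integral_deriv_mul (hu : RegWeak T u) (ht : t ∈ Ico 0 T) (hφ : IsTest φ c δ) :
    ∫ x, deriv (u t) x * φ x = -∫ x, u t x * deriv φ x := by
  obtain ⟨L, hL⟩ := hu.2.1 t ht (|c| + |δ| + 1) (by positivity)
  have hx : ∀ y, |y - c| ≤ δ → y ∈ Icc (-(|c| + |δ| + 1)) (|c| + |δ| + 1) := fun y hy => by
    have : |y| ≤ |y - c| + |c| := by simpa using abs_add_le (y - c) c
    exact abs_le.1 (by linarith [le_abs_self δ])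
  rw [hφ.integral_mul_deriv (C := L) fun x y hx' hy' => ?_, neg_neg]
  simpa [Real.dist_eq] using hL.dist_le_mul x (hx x hx') y (hx y hy')

/-- The equation satisfied in the sense of distributions by the spatial derivative. -/
theorem IsWeakSolution.hasDerivAt_integral_deriv (hu : IsWeakSolution T u) (ht : t ∈ Ioo 0 T)
    (hφ : IsTest φ c δ) :
    HasDerivAt (fun s => ∫ x, deriv (u s) x * φ x)
      (∫ x, (1/2 * (u t x * deriv (u t) x) * deriv (deriv φ) x
        - -(1/2) * (deriv (u t) x * deriv (u t) x) * deriv φ x)) t := by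
  have h := (hu.hasDerivAt_integral ht hφ.deriv).neg
  have ht' := Ioo_subset_Ico_self ht
  refine (h.congr_of_eventuallyEq ?_).congr_deriv ?_
  · filter_upwards [Ioo_mem_nhds ht.1 ht.2] with s hs
    exact hu.2.1.integral_deriv_mul (Ioo_subset_Ico_self hs) hφ
  · obtain ⟨-, i2, -⟩ := hu.2.1.integrable ht' hφ.deriv.deriv
    obtain ⟨-, -, i3⟩ := hu.2.1.integrable ht' hφ.deriv
    rw [← integral_add i2 i3, ← integral_const_mul, ← integral_neg]
    congr 1
    ext x
    ring

theorem RegWeak.abs_sub_le_of_deriv_bound (hu : RegWeak T u) (ht : t ∈ Ico 0 T) {L : ℝ}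
    (hL : ∀ z, |z - c| ≤ δ → |deriv (u t) z| ≤ L) (x y : ℝ) (hx : |x - c| ≤ δ)
    (hy : |y - c| ≤ δ) : |u t x - u t y| ≤ L * |x - y| := by
  obtain ⟨K, hK⟩ := hu.2.1 t ht (|c| + |δ| + 1) (by positivity)
  have hmem : ∀ z ∈ uIcc y x, |z - c| ≤ δ := fun z hz => by
    rw [abs_le] at hx hy ⊢
    rcases mem_uIcc.1 hz with h | h <;>
      exact ⟨by linarith [h.1, h.2], by linarith [h.1, h.2]⟩
  have hK' : LipschitzOnWith K (u t) (uIcc y x) := hK.mono fun z hz => by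
    have : |z| ≤ |z - c| + |c| := by simpa using abs_add_le (z - c) c
    exact abs_le.1 (by linarith [le_abs_self δ, hmem z hz])
  rw [← hK'.absolutelyContinuousOnInterval.integral_deriv_eq_sub, ← Real.norm_eq_abs]
  exact intervalIntegral.norm_integral_le_of_norm_le_const fun z hz =>
    hL z (hmem z (uIoc_subset_uIcc hz))

/-- Local bounds, uniform in time, for a weak solution and its spatial derivative. -/
theorem RegWeak.exists_holderNear (hu : RegWeak T u) (ht : t ∈ Ioo 0 T) (x₀ δ : ℝ) :
    ∃ C, ∀ᶠ s in nhds t, s ∈ Ioo 0 T ∧ HolderNear (u s) x₀ δ C 1 ∧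
      HolderNear (deriv (u s)) x₀ δ C 0 := by
  obtain ⟨h1, h2⟩ := hu.niceAt_indicator ht
  obtain ⟨M, hM⟩ := h1.bdd (|x₀| + δ)
  obtain ⟨L, hL⟩ := h2.bdd (|x₀| + δ)
  have hx : ∀ y, |y - x₀| ≤ δ → |y| ≤ |x₀| + δ := fun y hy => by
    have : |y| ≤ |y - x₀| + |x₀| := by simpa using abs_add_le (y - x₀) x₀
    linarith
  refine ⟨max M (2 * |L|), ?_⟩
  filter_upwards [hM, hL, Ioo_mem_nhds ht.1 ht.2] with s hsM hsL hs
  rw [indicator_of_mem hs] at hsM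
  have hs' := Ioo_subset_Ico_self hs
  have hsL' : ∀ y, |y - x₀| ≤ δ → |deriv (u s) y| ≤ |L| := fun y hy =>
    (hsL y (hx y hy)).trans (le_abs_self L)
  refine ⟨hs, ⟨(hu.continuous hs').measurable, fun x hx' => (hsM x (hx x hx')).trans
    (le_max_left _ _), fun x y hx' hy' => ?_⟩, ⟨measurable_deriv _, fun x hx' =>
    ((hsL' x hx').trans (by linarith [abs_nonneg L])).trans (le_max_right M (2 * |L|)),
    fun x y hx' hy' => ?_⟩⟩
  · rw [Real.rpow_one]
    refine ((hu.abs_sub_le_of_deriv_bound hs' (fun z hz => hsL' z hz) x y hx' hy').trans ?_)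
    exact mul_le_mul_of_nonneg_right
      ((show |L| ≤ 2 * |L| by linarith [abs_nonneg L]).trans (le_max_right _ _)) (abs_nonneg _)
  · rw [Real.rpow_zero, mul_one]
    refine ((abs_sub _ _).trans ?_).trans (le_max_right _ _)
    linarith [hsL' x hx', hsL' y hy']

end WeakSolution

section LocHolder

/-- Functions `g t x` that are `α`-Hölder continuous in `x`, locally uniformly near the points of
`P`. -/
def LocHolder (P : Set (ℝ × ℝ)) (α : ℝ) (g : ℝ → ℝ → ℝ) : Prop :=
  ∀ p ∈ P, ∃ C, ∀ᶠ δ in nhdsWithin (0:ℝ) (Ioi 0), ∀ t, |t - p.1| < δ →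
    HolderNear (g t) p.2 δ C α

/-- The equation `∂ₜ v = ∂ₓ² (u v / 2) + ∂ₓ G`, in the sense of distributions in `x`. -/
def LocEq (P : Set (ℝ × ℝ)) (u v G : ℝ → ℝ → ℝ) : Prop :=
  ∀ p ∈ P, ∀ᶠ δ in nhdsWithin (0:ℝ) (Ioi 0), ∀ t, |t - p.1| < δ → ∀ φ, IsTest φ p.2 δ →
    HasDerivAt (fun s => ∫ y, v s y * φ y)
      (∫ y, (1 / 2 * (u t y * v t y) * deriv (deriv φ) y - G t y * deriv φ y)) t

theorem eventually_pos_lt {η : ℝ} (hη : 0 < η) :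
    ∀ᶠ δ in nhdsWithin (0:ℝ) (Ioi 0), 0 < δ ∧ δ < η :=
  Ioo_mem_nhdsGT hη

variable {P : Set (ℝ × ℝ)} {g h : ℝ → ℝ → ℝ} {α : ℝ}

theorem eventually_box_subset (hP : IsOpen P) {p : ℝ × ℝ} (hp : p ∈ P) :
    ∀ᶠ δ in nhdsWithin (0:ℝ) (Ioi 0), ∀ t x, |t - p.1| ≤ δ → |x - p.2| ≤ δ → (t, x) ∈ P := by
  obtain ⟨ε, hε, h⟩ := Metric.isOpen_iff.1 hP p hp
  filter_upwards [eventually_pos_lt hε] with δ hδ t x ht hx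
  refine h ?_
  rw [Metric.mem_ball, Prod.dist_eq, max_lt_iff]
  exact ⟨ht.trans_lt hδ.2, hx.trans_lt hδ.2⟩

theorem LocHolder.of_exists (h : ∀ p ∈ P, ∃ C, ∃ δ > 0, ∀ t, |t - p.1| < δ →
    HolderNear (g t) p.2 δ C α) : LocHolder P α g := fun p hp => by
  obtain ⟨C, δ, hδ, h⟩ := h p hp
  refine ⟨C, ?_⟩
  filter_upwards [eventually_pos_lt hδ] with δ' hδ' t ht
  exact (h t (ht.trans hδ'.2)).mono (by simpa using hδ'.2.le) le_rfl

theorem LocHolder.const (a : ℝ) : LocHolder P α fun _ _ => a := fun p _ => by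
  refine ⟨|a|, Eventually.of_forall fun δ t _ =>
    ⟨measurable_const, fun _ _ => le_rfl, fun x y _ _ => ?_⟩⟩
  rw [sub_self, abs_zero]
  positivity

theorem LocHolder.add (hg : LocHolder P α g) (hh : LocHolder P α h) :
    LocHolder P α fun t x => g t x + h t x := fun p hp => by
  obtain ⟨C, hC⟩ := hg p hp
  obtain ⟨D, hD⟩ := hh p hp
  refine ⟨C + D, ?_⟩
  filter_upwards [hC, hD] with δ h1 h2 t ht
  refine ⟨(h1 t ht).meas.add (h2 t ht).meas, fun x hx => (abs_add_le _ _).trans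
    (add_le_add ((h1 t ht).bound x hx) ((h2 t ht).bound x hx)), fun x y hx hy => ?_⟩
  rw [add_sub_add_comm, add_mul]
  exact (abs_add_le _ _).trans
    (add_le_add ((h1 t ht).holder x y hx hy) ((h2 t ht).holder x y hx hy))

theorem LocHolder.mul (hg : LocHolder P α g) (hh : LocHolder P α h) :
    LocHolder P α fun t x => g t x * h t x := fun p hp => by
  obtain ⟨C, hC⟩ := hg p hp
  obtain ⟨D, hD⟩ := hh p hp
  refine ⟨2 * C * D, ?_⟩
  filter_upwards [hC, hD, eventually_pos_lt one_pos] with δ h1 h2 hδ t ht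
  have hC0 := (h1 t ht).nonneg hδ.1.le
  have hD0 := (h2 t ht).nonneg hδ.1.le
  refine ⟨(h1 t ht).meas.mul (h2 t ht).meas, fun x hx => ?_, fun x y hx hy => ?_⟩
  · rw [abs_mul]
    have := mul_le_mul ((h1 t ht).bound x hx) ((h2 t ht).bound x hx) (abs_nonneg _) hC0
    nlinarith [mul_nonneg hC0 hD0]
  · have e : g t x * h t x - g t y * h t y
      = g t x * (h t x - h t y) + (g t x - g t y) * h t y := by ring
    rw [e]
    refine (abs_add_le _ _).trans ?_
    rw [abs_mul, abs_mul]
    have a1 := mul_le_mul ((h1 t ht).bound x hx) ((h2 t ht).holder x y hx hy) (abs_nonneg _) hC0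
    have a2 := mul_le_mul ((h1 t ht).holder x y hx hy) ((h2 t ht).bound y hy) (abs_nonneg _)
      (by positivity)
    linarith

theorem rpow_le_rpow_of_near {x y c δ β : ℝ} (hβ : β ≤ α) (hβ0 : 0 ≤ β) (hδ : δ ≤ 1 / 2)
    (hx : |x - c| ≤ δ) (hy : |y - c| ≤ δ) : |x - y| ^ α ≤ |x - y| ^ β := by
  have h1 : |x - y| ≤ 1 := by
    have := abs_sub_le x c y
    rw [abs_sub_comm c y] at this
    linarith
  rcases (abs_nonneg (x - y)).eq_or_lt with h0 | h0
  · rw [← h0]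
    rcases hβ0.eq_or_lt with hβ' | hβ'
    · rw [← hβ', Real.rpow_zero]; exact Real.rpow_le_one le_rfl zero_le_one (by linarith)
    · rw [Real.zero_rpow hβ'.ne', Real.zero_rpow (hβ'.trans_le hβ).ne']
  · exact Real.rpow_le_rpow_of_exponent_ge h0 h1 hβ

theorem LocHolder.mono (hg : LocHolder P α g) {β : ℝ} (hβ : β ≤ α) (hβ0 : 0 ≤ β) :
    LocHolder P β g := fun p hp => by
  obtain ⟨C, hC⟩ := hg p hp
  refine ⟨C, ?_⟩
  filter_upwards [hC, eventually_pos_lt (one_half_pos (α := ℝ))] with δ h1 hδ t ht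
  exact ⟨(h1 t ht).meas, (h1 t ht).bound, fun x y hx hy => ((h1 t ht).holder x y hx hy).trans
    (mul_le_mul_of_nonneg_left (rpow_le_rpow_of_near hβ hβ0 hδ.2.le hx hy)
      ((h1 t ht).nonneg hδ.1.le))⟩

theorem LocHolder.of_hasDerivAt (hP : IsOpen P) {g' : ℝ → ℝ → ℝ} (hg : LocHolder P 0 g)
    (hg' : LocHolder P 0 g')
    (hd : ∀ p ∈ P, HasDerivAt (g p.1) (g' p.1 p.2) p.2) (hα : α ≤ 1) (hα0 : 0 ≤ α) :
    LocHolder P α g := by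
  refine LocHolder.mono (α := 1) (fun p hp => ?_) hα hα0
  obtain ⟨C, hC⟩ := hg p hp
  obtain ⟨D, hD⟩ := hg' p hp
  refine ⟨max C D, ?_⟩
  filter_upwards [hC, hD, eventually_box_subset hP hp] with δ h1 h2 hδ t ht
  refine ⟨(h1 t ht).meas, fun x hx => ((h1 t ht).bound x hx).trans (le_max_left _ _),
    fun x y hx hy => ?_⟩
  rw [Real.rpow_one]
  have hmem : ∀ z, |z - p.2| ≤ δ ↔ z ∈ Icc (p.2 - δ) (p.2 + δ) := fun z => by
    rw [abs_le, mem_Icc]; constructor <;> rintro ⟨a, b⟩ <;> constructor <;> linarith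
  refine (Convex.norm_image_sub_le_of_norm_hasDerivWithin_le (f := g t) (f' := g' t)
    (s := Icc (p.2 - δ) (p.2 + δ)) (C := D)
    (fun z hz => (hd (t, z) (hδ t z ht.le ((hmem z).2 hz))).hasDerivWithinAt)
    (fun z hz => (h2 t ht).bound z ((hmem z).2 hz)) (convex_Icc _ _)
    ((hmem y).1 hy) ((hmem x).1 hx)).trans ?_
  exact mul_le_mul_of_nonneg_right (le_max_right _ _) (abs_nonneg _)

end LocHolder

/-- Local form on the open set `P` of the weak formulation, for a positive solution `u`. -/
structure WeakOn (P : Set (ℝ × ℝ)) (u : ℝ → ℝ → ℝ) : Prop where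
  isOpen : IsOpen P
  pos : ∀ p ∈ P, ∃ m > 0, ∀ᶠ δ in nhdsWithin (0:ℝ) (Ioi 0), ∀ t x, |t - p.1| ≤ δ →
    |x - p.2| ≤ δ → m ≤ u t x
  lip : LocHolder P 1 u
  bdd : LocHolder P 0 fun t => deriv (u t)
  eqn : ∀ p ∈ P, ∀ᶠ δ in nhdsWithin (0:ℝ) (Ioi 0), ∀ t, |t - p.1| < δ → ∀ φ, IsTest φ p.2 δ →
    HasDerivAt (fun s => ∫ x, u s x * φ x) (-(1/2) * ((∫ x, u t x * deriv (u t) x * deriv φ x)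
      + ∫ x, deriv (u t) x * deriv (u t) x * φ x)) t
  eqn_deriv : LocEq P u (fun t => deriv (u t)) fun t x => -(1/2) * (deriv (u t) x * deriv (u t) x)

section Gain

variable {P : Set (ℝ × ℝ)} {u v G U : ℝ → ℝ → ℝ} {α : ℝ}

theorem WeakOn.exists_smoothing (H : WeakOn P u) (hα : 0 ≤ α)
    (hq : LocHolder P α fun t => deriv (u t)) (hv : LocHolder P α v) (hG : LocHolder P α G)
    (hE : LocEq P u v G) {p : ℝ × ℝ} (hp : p ∈ P) {η : ℝ} (hη : 0 < η) :
    ∃ δ, 0 < δ ∧ δ < η ∧ ∃ ε₀, 0 < ε₀ ∧ ε₀ ≤ δ ∧ ∀ κ, IsTest κ 0 1 → ∃ K, 0 ≤ K ∧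
      ∀ t ε x, |t - p.1| ≤ δ → 0 < ε → ε ≤ ε₀ → |x - p.2| ≤ δ →
        |moll (deriv (deriv κ)) ε (v t) x| ≤ K * (√ε * ε ^ α) := by
  obtain ⟨m, hm, hpos⟩ := H.pos p hp
  obtain ⟨C₁, h₁⟩ := H.lip p hp
  obtain ⟨C₂, h₂⟩ := hq p hp
  obtain ⟨C₃, h₃⟩ := hv p hp
  obtain ⟨C₄, h₄⟩ := hG p hp
  obtain ⟨δ, hδ0, hpos, h₁, h₂, h₃, h₄, hE⟩ := ((eventually_pos_lt hη).and (hpos.and (h₁.and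
    (h₂.and (h₃.and (h₄.and (hE p hp))))))).exists
  set C := max (max C₁ C₂) (max C₃ C₄)
  have c₁ : C₁ ≤ C := (le_max_left _ _).trans (le_max_left _ _)
  have c₂ : C₂ ≤ C := (le_max_right _ _).trans (le_max_left _ _)
  have c₃ : C₃ ≤ C := (le_max_left _ _).trans (le_max_right _ _)
  have c₄ : C₄ ≤ C := (le_max_right _ _).trans (le_max_right _ _)
  have hδδ : |p.2 - p.2| + δ ≤ δ := by simp
  refine ⟨δ / 2, by linarith, by linarith, min (min 1 (δ / 2)) ((δ / 8) ^ 2), ?_,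
    (min_le_left _ _).trans (min_le_right _ _), fun κ hκ => ?_⟩
  · have := hδ0.1
    positivity
  obtain ⟨K, hK, h⟩ := moll_smoothing (M := C₁) hδ0.1 hm hα
    (fun t ht x hx => ⟨hpos t x ht.le hx, (le_abs_self _).trans ((h₁ t ht).bound x hx)⟩)
    (fun t ht => (h₁ t ht).mono hδδ c₁) (fun t ht => (h₂ t ht).mono hδδ c₂)
    (fun t ht => (h₃ t ht).mono hδδ c₃) (fun t ht => (h₄ t ht).mono hδδ c₄) hE hκ
  refine ⟨K, hK, fun t ε x ht hε hεε hx => h ε t x hε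
    (hεε.trans ((min_le_left _ _).trans (min_le_left _ _))) ?_ ht hx⟩
  exact (Real.sqrt_le_left (by linarith [hδ0.1])).2 (hεε.trans (min_le_right _ _))

/-- Gain of regularity for a spatial derivative `v = ∂ₓ U` solving an equation with Hölder
coefficients. -/
theorem WeakOn.gain_holder (H : WeakOn P u) (hα : 0 ≤ α) (hα' : α < 1 / 2)
    (hq : LocHolder P α fun t => deriv (u t)) (hv : LocHolder P α v) (hG : LocHolder P α G)
    (hE : LocEq P u v G) (hU : LocHolder P 1 U) (hUv : ∀ t, v t = deriv (U t)) :
    (∀ p ∈ P, HasDerivAt (U p.1) (v p.1 p.2) p.2) ∧ LocHolder P (1 / 2 + α) v := by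
  suffices h : ∀ p ∈ P, ∃ K δ, 0 < δ ∧ ∀ t, |t - p.1| ≤ δ →
      (∀ x, |x - p.2| < δ → DifferentiableAt ℝ (U t) x) ∧
      HolderNear (v t) p.2 (δ / 2) K (1 / 2 + α) by
    refine ⟨fun p hp => ?_, LocHolder.of_exists fun p hp => ?_⟩
    · obtain ⟨K, δ, hδ, h⟩ := h p hp
      rw [hUv]
      exact ((h p.1 (by simpa using hδ.le)).1 p.2 (by simpa using hδ)).hasDerivAt
    · obtain ⟨K, δ, hδ, h⟩ := h p hp
      exact ⟨K, δ / 2, by linarith, fun t ht => (h t (by linarith)).2⟩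
  intro p hp
  obtain ⟨C₁, h₁⟩ := hU p hp
  obtain ⟨C₂, h₂⟩ := hv p hp
  obtain ⟨δ', hδ', h₁, h₂⟩ := ((eventually_pos_lt one_pos).and (h₁.and h₂)).exists
  obtain ⟨δ, hδ, hδδ, ε₀, hε₀, hεδ, hs⟩ := H.exists_smoothing hα hq hv hG hE hp
    (show 0 < δ' / 4 by linarith [hδ'.1])
  have h₁' : ∀ i : {t // |t - p.1| ≤ δ}, HolderNear (U i) p.2 δ' C₁ 1 := fun i =>
    h₁ _ (i.2.trans_lt (by linarith))
  have h₂' : ∀ i : {t // |t - p.1| ≤ δ}, HolderNear (v i) p.2 δ' C₂ α := fun i =>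
    h₂ _ (i.2.trans_lt (by linarith))
  have i₀ : {t // |t - p.1| ≤ δ} := ⟨p.1, by simpa using hδ.le⟩
  have hb : ∀ χ, IsTest χ 0 1 → ∃ D, 0 ≤ D ∧ ∀ (i : {t // |t - p.1| ≤ δ}) ε x, 0 < ε → ε ≤ ε₀ →
      |x - p.2| ≤ δ → |moll (deriv (deriv χ)) ε (v i) x| ≤ D * ε ^ (1 / 2 + α) := by
    intro χ hχ
    obtain ⟨K, hK, h⟩ := hs χ hχ
    refine ⟨K, hK, fun i ε x hε hεε hx => ?_⟩
    rw [Real.rpow_add hε, ← Real.sqrt_eq_rpow]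
    exact h i ε x i.2 hε hεε hx
  obtain ⟨K, hK⟩ := exists_holderNear_deriv (U := fun i : {t // |t - p.1| ≤ δ} => U i) (x₀ := p.2)
    (C := C₁) (α := 1) (γ := 1 / 2 + α) hδ hε₀ ((h₁' i₀).nonneg hδ'.1.le) one_pos (by linarith)
    (fun i => (h₁' i).mono (by simp; linarith) le_rfl) fun χ hχ => by
      obtain ⟨K, hK0, hK⟩ := exists_moll_deriv_bound hχ hε₀ ((h₂' i₀).nonneg hδ'.1.le)
        (by linarith) (by linarith) (fun i => (h₂' i).meas)
        (fun i y hy => (h₂' i).bound y (by linarith)) hb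
      refine ⟨K, hK0, fun i ε x hε hεε hx => ?_⟩
      rw [moll_deriv_eq (C := C₁) hχ.deriv hε, ← hUv, abs_mul, abs_of_pos hε]
      · have := mul_le_mul_of_nonneg_left (hK i ε x hε hεε hx) hε.le
        linarith
      · intro y z hy hz
        have hy' := abs_sub_le y x p.2
        have hz' := abs_sub_le z x p.2
        simpa using (h₁' i).holder y z (by linarith) (by linarith)
  refine ⟨K, δ, hδ, fun t ht => ?_⟩
  rw [hUv]
  exact hK ⟨t, ht⟩

/-- Differentiability of a solution of an equation with `3/4`-Hölder coefficients. -/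
theorem WeakOn.gain_deriv (H : WeakOn P u)
    (hq : LocHolder P (3 / 4) fun t => deriv (u t)) (hv : LocHolder P (3 / 4) v)
    (hG : LocHolder P (3 / 4) G) (hE : LocEq P u v G) :
    (∀ p ∈ P, HasDerivAt (v p.1) (deriv (v p.1) p.2) p.2) ∧
      LocHolder P (1 / 4) fun t => deriv (v t) := by
  suffices h : ∀ p ∈ P, ∃ K δ, 0 < δ ∧ ∀ t, |t - p.1| ≤ δ →
      (∀ x, |x - p.2| < δ → DifferentiableAt ℝ (v t) x) ∧
      HolderNear (deriv (v t)) p.2 (δ / 2) K (1 / 4) by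
    refine ⟨fun p hp => ?_, LocHolder.of_exists fun p hp => ?_⟩
    · obtain ⟨K, δ, hδ, h⟩ := h p hp
      exact ((h p.1 (by simpa using hδ.le)).1 p.2 (by simpa using hδ)).hasDerivAt
    · obtain ⟨K, δ, hδ, h⟩ := h p hp
      exact ⟨K, δ / 2, by linarith, fun t ht => (h t (by linarith)).2⟩
  intro p hp
  obtain ⟨C₂, h₂⟩ := hv p hp
  obtain ⟨δ', hδ', h₂⟩ := ((eventually_pos_lt one_pos).and h₂).exists
  obtain ⟨δ, hδ, hδδ, ε₀, hε₀, hεδ, hs⟩ := H.exists_smoothing (by norm_num) hq hv hG hE hp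
    (show 0 < δ' / 4 by linarith [hδ'.1])
  have h₂' : ∀ i : {t // |t - p.1| ≤ δ}, HolderNear (v i) p.2 δ' C₂ (3 / 4) := fun i =>
    h₂ _ (i.2.trans_lt (by linarith))
  have i₀ : {t // |t - p.1| ≤ δ} := ⟨p.1, by simpa using hδ.le⟩
  obtain ⟨K, hK⟩ := exists_holderNear_deriv (U := fun i : {t // |t - p.1| ≤ δ} => v i) (x₀ := p.2)
    (C := C₂) (α := 3 / 4) (γ := 1 / 4) hδ hε₀ ((h₂' i₀).nonneg hδ'.1.le) (by norm_num)
    (by norm_num) (fun i => (h₂' i).mono (by simp; linarith) le_rfl) fun χ hχ => by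
      obtain ⟨K, hK, h⟩ := hs χ hχ
      refine ⟨K, hK, fun i ε x hε hεε hx => ?_⟩
      have e : ε * ε ^ (1 / 4 : ℝ) = √ε * ε ^ (3 / 4 : ℝ) := by
        rw [Real.sqrt_eq_rpow, ← Real.rpow_add hε, ← Real.rpow_one_add' hε.le (by norm_num)]
        norm_num
      rw [e]
      exact h i ε x i.2 hε hεε hx
  exact ⟨K, δ, hδ, fun t ht => hK ⟨t, ht⟩⟩

end Gain

section Polynomial

/-- Polynomial expressions in the first `n + 1` members of a sequence of functions. -/
inductive PolyIn (v : ℕ → ℝ → ℝ → ℝ) (n : ℕ) : (ℝ → ℝ → ℝ) → Prop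
  | var (i : ℕ) (hi : i ≤ n) : PolyIn v n (v i)
  | const (a : ℝ) : PolyIn v n fun _ _ => a
  | add {g h : ℝ → ℝ → ℝ} : PolyIn v n g → PolyIn v n h → PolyIn v n fun t x => g t x + h t x
  | mul {g h : ℝ → ℝ → ℝ} : PolyIn v n g → PolyIn v n h → PolyIn v n fun t x => g t x * h t x

variable {P : Set (ℝ × ℝ)} {v : ℕ → ℝ → ℝ → ℝ} {n : ℕ} {g : ℝ → ℝ → ℝ} {α : ℝ}

theorem PolyIn.mono (hg : PolyIn v n g) {m : ℕ} (h : n ≤ m) : PolyIn v m g := by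
  induction hg with
  | var i hi => exact .var i (hi.trans h)
  | const a => exact .const a
  | add _ _ h1 h2 => exact h1.add h2
  | mul _ _ h1 h2 => exact h1.mul h2

theorem PolyIn.locHolder (hg : PolyIn v n g) (hv : ∀ i ≤ n, LocHolder P α (v i)) :
    LocHolder P α g := by
  induction hg with
  | var i hi => exact hv i hi
  | const a => exact .const a
  | add _ _ h1 h2 => exact h1.add h2
  | mul _ _ h1 h2 => exact h1.mul h2

theorem PolyIn.exists_deriv (hg : PolyIn v n g) : ∃ g', PolyIn v (n + 1) g' ∧
    ∀ t x, (∀ i ≤ n, HasDerivAt (v i t) (v (i + 1) t x) x) → HasDerivAt (g t) (g' t x) x := by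
  induction hg with
  | var i hi => exact ⟨_, .var (i + 1) (by omega), fun t x h => h i hi⟩
  | const a => exact ⟨_, .const 0, fun t x _ => hasDerivAt_const x a⟩
  | add _ _ h1 h2 =>
    obtain ⟨g', hg', h1⟩ := h1
    obtain ⟨h', hh', h2⟩ := h2
    exact ⟨_, hg'.add hh', fun t x h => (h1 t x h).add (h2 t x h)⟩
  | mul hg hh h1 h2 =>
    obtain ⟨g', hg', h1⟩ := h1
    obtain ⟨h', hh', h2⟩ := h2
    exact ⟨_, (hg'.mul (hh.mono (Nat.le_succ n))).add ((hg.mono (Nat.le_succ n)).mul hh'),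
      fun t x h => (h1 t x h).mul (h2 t x h)⟩

end Polynomial

/-- `g` is differentiable in `x` on `P` with derivative `g'`, both being locally bounded. -/
structure LocDiff (P : Set (ℝ × ℝ)) (g g' : ℝ → ℝ → ℝ) : Prop where
  bdd : LocHolder P 0 g
  bdd_deriv : LocHolder P 0 g'
  hasDerivAt : ∀ p ∈ P, HasDerivAt (g p.1) (g' p.1 p.2) p.2

section LocDiff

variable {P : Set (ℝ × ℝ)} {g g' h h' : ℝ → ℝ → ℝ}

theorem LocDiff.mul (hg : LocDiff P g g') (hh : LocDiff P h h') :
    LocDiff P (fun t x => g t x * h t x) (fun t x => g' t x * h t x + g t x * h' t x) :=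
  ⟨hg.bdd.mul hh.bdd, (hg.bdd_deriv.mul hh.bdd).add (hg.bdd.mul hh.bdd_deriv), fun p hp =>
    (hg.hasDerivAt p hp).mul (hh.hasDerivAt p hp)⟩

theorem LocHolder.integrable {α : ℝ} (hg : LocHolder P α g) : ∀ p ∈ P,
    ∀ᶠ δ in nhdsWithin (0:ℝ) (Ioi 0), ∀ t, |t - p.1| < δ → ∀ φ, IsTest φ p.2 δ →
      Integrable (fun y => g t y * φ y) := fun p hp => by
  obtain ⟨C, hC⟩ := hg p hp
  filter_upwards [hC] with δ h t ht φ hφ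
  exact hφ.integrable_mul (h t ht).meas (h t ht).bound

theorem LocDiff.integral_mul_deriv (hP : IsOpen P) (hg : LocDiff P g g') : ∀ p ∈ P,
    ∀ᶠ δ in nhdsWithin (0:ℝ) (Ioi 0), ∀ t, |t - p.1| < δ → ∀ φ, IsTest φ p.2 δ →
      ∫ y, g t y * deriv φ y = -∫ y, g' t y * φ y := fun p hp => by
  obtain ⟨C, hC⟩ := LocHolder.of_hasDerivAt hP hg.bdd hg.bdd_deriv hg.hasDerivAt le_rfl zero_le_one
    p hp
  filter_upwards [hC, eventually_box_subset hP hp] with δ h hbox t ht φ hφ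
  rw [hφ.integral_mul_deriv fun x y hx hy => by simpa using (h t ht).holder x y hx hy]
  congr 2
  ext y
  rcases le_or_gt |y - p.2| δ with hy | hy
  · rw [(hg.hasDerivAt (t, y) (hbox t y ht.le hy)).deriv]
  · rw [hφ.zero y hy, mul_zero, mul_zero]

theorem eventually_abs_sub_lt_of_lt {t s δ : ℝ} (h : |t - s| < δ) : ∀ᶠ r in nhds t, |r - s| < δ :=
  (isOpen_lt (by fun_prop) continuous_const).mem_nhds h

theorem LocEq.deriv {u u' v v' G G' W' : ℝ → ℝ → ℝ} (hP : IsOpen P) (hE : LocEq P u v G)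
    (hu : LocDiff P u u') (hv : LocDiff P v v') (hG : LocDiff P G G')
    (hW : LocDiff P (fun t x => u' t x * v t x) W') :
    LocEq P u v' fun t x => G' t x + 1 / 2 * W' t x := fun p hp => by
  filter_upwards [hE p hp, hv.integral_mul_deriv hP p hp, hG.integral_mul_deriv hP p hp,
    hW.integral_mul_deriv hP p hp, (hu.mul hv).integral_mul_deriv hP p hp,
    (hu.mul hv).bdd.integrable p hp, hG.bdd.integrable p hp, hG.bdd_deriv.integrable p hp,
    hW.bdd.integrable p hp, hW.bdd_deriv.integrable p hp,
    (hu.bdd.mul hv.bdd_deriv).integrable p hp]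
    with δ hE pv pG pW pA iA iG iG' iW iW' iB t ht φ hφ
  refine ((hE t ht _ hφ.deriv).neg.congr_of_eventuallyEq ?_).congr_deriv ?_
  · filter_upwards [eventually_abs_sub_lt_of_lt ht] with s hs
    rw [Pi.neg_apply, pv s hs φ hφ, neg_neg]
  · have e1 : ∀ y, (1 / 2 * (u t y * v t y) * _root_.deriv (_root_.deriv (_root_.deriv φ)) y
        - G t y * _root_.deriv (_root_.deriv φ) y)
        = 1 / 2 * (u t y * v t y * _root_.deriv (_root_.deriv (_root_.deriv φ)) y)
        - G t y * _root_.deriv (_root_.deriv φ) y := fun y => by ring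
    have e2 : ∀ y, (1 / 2 * (u t y * v' t y) * _root_.deriv (_root_.deriv φ) y
        - (G' t y + 1 / 2 * W' t y) * _root_.deriv φ y)
        = (1 / 2 * (u t y * v' t y * _root_.deriv (_root_.deriv φ) y)
        - G' t y * _root_.deriv φ y) - 1 / 2 * (W' t y * _root_.deriv φ y) := fun y => by ring
    have h2 := hφ.deriv.deriv
    have h3 := h2.deriv
    have i1 := iB t ht _ h2
    have i2 := iG' t ht _ hφ.deriv
    have i3 : Integrable fun y => 1 / 2 * (u t y * v' t y * _root_.deriv (_root_.deriv φ) y)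
        - G' t y * _root_.deriv φ y := (i1.const_mul _).sub i2
    simp only [e1, e2]
    rw [integral_sub ((iA t ht _ h3).const_mul _) (iG t ht _ h2),
      integral_sub i3 ((iW' t ht _ hφ.deriv).const_mul _), integral_sub (i1.const_mul _) i2,
      integral_const_mul, integral_const_mul, integral_const_mul]
    have a1 := pA t ht _ h2
    have a2 := pG t ht _ hφ.deriv
    have a3 := pW t ht _ hφ.deriv
    have e3 : ∀ y, (u' t y * v t y + u t y * v' t y) * _root_.deriv (_root_.deriv φ) y
      = u' t y * v t y * _root_.deriv (_root_.deriv φ) y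
        + u t y * v' t y * _root_.deriv (_root_.deriv φ) y := fun y => by ring
    simp only [e3] at a1
    rw [integral_add (iW t ht _ h2) i1] at a1
    rw [a1, a2, a3]
    ring

end LocDiff

/-- Iterated spatial derivatives. -/
def xderiv (u : ℝ → ℝ → ℝ) : ℕ → ℝ → ℝ → ℝ
  | 0 => u
  | n + 1 => fun t => deriv (xderiv u n t)

/-- Hölder regularity of the first `n` spatial derivatives. -/
structure XReg (P : Set (ℝ × ℝ)) (u : ℝ → ℝ → ℝ) (n : ℕ) : Prop where
  holder : ∀ i ≤ n, LocHolder P (1 / 4) (xderiv u i)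
  hasDerivAt : ∀ i < n, ∀ p ∈ P, HasDerivAt (xderiv u i p.1) (xderiv u (i + 1) p.1 p.2) p.2
  eqn : ∃ G, PolyIn (xderiv u) n G ∧ LocEq P u (xderiv u n) G

section Induction

variable {P : Set (ℝ × ℝ)} {u : ℝ → ℝ → ℝ}

theorem XReg.lip {n : ℕ} (h : XReg P u n) (hP : IsOpen P) {i : ℕ} (hi : i < n) :
    LocHolder P 1 (xderiv u i) :=
  LocHolder.of_hasDerivAt hP ((h.holder i hi.le).mono (by norm_num) le_rfl)
    ((h.holder (i + 1) hi).mono (by norm_num) le_rfl) (h.hasDerivAt i hi) le_rfl zero_le_one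

theorem WeakOn.xReg_one (H : WeakOn P u) : XReg P u 1 := by
  have hG : PolyIn (xderiv u) 1 fun t x => -(1 / 2) * (deriv (u t) x * deriv (u t) x) :=
    (PolyIn.const _).mul ((PolyIn.var 1 le_rfl).mul (PolyIn.var 1 le_rfl))
  obtain ⟨h1, h2⟩ := H.gain_holder le_rfl (by norm_num) H.bdd H.bdd
    ((LocHolder.const _).mul (H.bdd.mul H.bdd)) H.eqn_deriv H.lip fun t => rfl
  refine ⟨fun i hi => ?_, fun i hi p hp => ?_, ⟨_, hG, H.eqn_deriv⟩⟩
  · interval_cases i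
    · exact H.lip.mono (by norm_num) (by norm_num)
    · exact h2.mono (by norm_num) (by norm_num)
  · interval_cases i
    exact h1 p hp

theorem WeakOn.xReg_succ (H : WeakOn P u) {n : ℕ} (h : XReg P u (n + 1)) : XReg P u (n + 2) := by
  obtain ⟨G, hG, hE⟩ := h.eqn
  have hq : PolyIn (xderiv u) (n + 1) fun t => deriv (u t) := .var 1 (by omega)
  obtain ⟨-, h1⟩ := H.gain_holder (by norm_num) (by norm_num) (hq.locHolder h.holder)
    (h.holder (n + 1) le_rfl) (hG.locHolder h.holder) hE (h.lip H.isOpen (Nat.lt_succ_self n))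
    fun t => rfl
  have h34 : ∀ i ≤ n + 1, LocHolder P (3 / 4) (xderiv u i) := fun i hi => by
    rcases hi.eq_or_lt with rfl | hi
    · exact h1.mono (by norm_num) (by norm_num)
    · exact (h.lip H.isOpen hi).mono (by norm_num) (by norm_num)
  obtain ⟨hd, h14⟩ := H.gain_deriv (hq.locHolder h34) (h34 _ le_rfl) (hG.locHolder h34) hE
  have holder : ∀ i ≤ n + 2, LocHolder P (1 / 4) (xderiv u i) := fun i hi => by
    rcases hi.eq_or_lt with rfl | hi
    · exact h14
    · exact h.holder i (by omega)
  have hderiv : ∀ i < n + 2, ∀ p ∈ P,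
      HasDerivAt (xderiv u i p.1) (xderiv u (i + 1) p.1 p.2) p.2 := fun i hi p hp => by
    rcases (Nat.lt_succ_iff.1 hi).eq_or_lt with rfl | hi
    · exact hd p hp
    · exact h.hasDerivAt i hi p hp
  have hdiff : ∀ g, PolyIn (xderiv u) (n + 1) g → ∃ g', PolyIn (xderiv u) (n + 2) g' ∧
      LocDiff P g g' := fun g hg => by
    obtain ⟨g', hg', hgd⟩ := hg.exists_deriv
    exact ⟨g', hg', (hg.locHolder h.holder).mono (by norm_num) le_rfl,
      (hg'.locHolder holder).mono (by norm_num) le_rfl,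
      fun p hp => hgd p.1 p.2 fun i hi => hderiv i (by omega) p hp⟩
  have hvar : ∀ i ≤ n + 1, LocDiff P (xderiv u i) (xderiv u (i + 1)) := fun i hi =>
    ⟨(holder i (by omega)).mono (by norm_num) le_rfl,
      (holder (i + 1) (by omega)).mono (by norm_num) le_rfl, hderiv i (by omega)⟩
  obtain ⟨G', hG', hGG'⟩ := hdiff G hG
  obtain ⟨W', hW', hWW'⟩ := hdiff _ (hq.mul (.var (n + 1) le_rfl))
  exact ⟨holder, hderiv, _, hG'.add ((PolyIn.const _).mul hW'),
    hE.deriv H.isOpen (hvar 0 (by omega)) (hvar (n + 1) le_rfl) hGG' hWW'⟩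

theorem WeakOn.xReg (H : WeakOn P u) (n : ℕ) : XReg P u (n + 1) := by
  induction n with
  | zero => exact H.xReg_one
  | succ n ih => exact H.xReg_succ ih

end Induction

/-- The equation `∂ₜ v = S`, in the sense of distributions in `x`. -/
def TimeEq (P : Set (ℝ × ℝ)) (v S : ℝ → ℝ → ℝ) : Prop :=
  ∀ p ∈ P, ∀ᶠ δ in nhdsWithin (0:ℝ) (Ioi 0), ∀ t, |t - p.1| < δ → ∀ φ, IsTest φ p.2 δ →
    HasDerivAt (fun s => ∫ y, v s y * φ y) (∫ y, S t y * φ y) t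

section TimeEq

variable {P : Set (ℝ × ℝ)} {u v v' S S' : ℝ → ℝ → ℝ} {α : ℝ}

theorem TimeEq.deriv (hP : IsOpen P) (h : TimeEq P v S) (hv : LocDiff P v v')
    (hS : LocDiff P S S') : TimeEq P v' S' := fun p hp => by
  filter_upwards [h p hp, hv.integral_mul_deriv hP p hp, hS.integral_mul_deriv hP p hp]
    with δ h pv pS t ht φ hφ
  refine ((h t ht _ hφ.deriv).neg.congr_of_eventuallyEq ?_).congr_deriv ?_
  · filter_upwards [eventually_abs_sub_lt_of_lt ht] with s hs
    rw [Pi.neg_apply, pv s hs φ hφ, neg_neg]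
  · rw [pS t ht φ hφ, neg_neg]

theorem TimeEq.hasDerivAt (h : TimeEq P v S) (hα : 0 < α) (hv : LocHolder P α v)
    (hS : LocHolder P α S) : ∀ p ∈ P, HasDerivAt (fun s => v s p.2) (S p.1 p.2) p.1 :=
    fun p hp => by
  obtain ⟨C, hC⟩ := hv p hp
  obtain ⟨D, hD⟩ := hS p hp
  obtain ⟨φ, hφ, h1⟩ := exists_unit_test
  obtain ⟨B, hB0, hB⟩ := hφ.exists_bound
  obtain ⟨δ, hC, hD, h, hδ⟩ :=
    (hC.and (hD.and ((h p hp).and (eventually_pos_lt one_pos)))).exists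
  have hlim : ∀ K, Tendsto (fun ε : ℝ => 2 * B * (K * ε ^ α)) (nhdsWithin 0 (Ioi 0)) (nhds 0) :=
    fun K => by
      have : Tendsto (fun ε : ℝ => 2 * B * (K * ε ^ α)) (nhds 0)
          (nhds (2 * B * (K * (0:ℝ) ^ α))) :=
        ((Real.continuousAt_rpow_const 0 α (.inr hα.le)).const_mul K).const_mul _
      rw [Real.zero_rpow hα.ne', mul_zero, mul_zero] at this
      exact this.mono_left nhdsWithin_le_nhds
  have happ : ∀ {K : ℝ} {g : ℝ → ℝ}, HolderNear g p.2 δ K α → ∀ ε, 0 < ε ∧ ε < δ →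
      |moll φ ε g p.2 - g p.2| ≤ 2 * B * (K * ε ^ α) := fun hg ε hε => by
    have hx : |p.2 - p.2| + ε ≤ δ := by simpa using hε.2.le
    exact abs_moll_sub_le hφ h1 hB hε.1 hg.meas (fun _ hy => hg.bound_of_near hx hy)
      fun _ hy => hg.osc_le hα.le hx hy
  refine hasDerivAt_of_tendstoUniformlyOn (l := nhdsWithin (0:ℝ) (Ioi 0))
    (s := {t | |t - p.1| < δ}) (f := fun ε t => moll φ ε (v t) p.2)
    (f' := fun ε t => moll φ ε (S t) p.2) (g' := fun t => S t p.2)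
    (isOpen_lt (by fun_prop) continuous_const) ?_ ?_ ?_ (by simpa using hδ.1)
  · rw [Metric.tendstoUniformlyOn_iff]
    intro e he
    filter_upwards [eventually_pos_lt hδ.1, (hlim D).eventually_lt_const he] with ε hε hlt t ht
    rw [dist_comm]
    exact (happ (hD t ht) ε hε).trans_lt hlt
  · filter_upwards [eventually_pos_lt hδ.1] with ε hε t ht
    exact (h t ht _ ((hφ.comp_mollifier hε.1 p.2).mono (by simpa using hε.2.le))).const_mul _
  · intro t ht
    rw [tendsto_iff_dist_tendsto_zero]
    refine squeeze_zero' (Eventually.of_forall fun _ => dist_nonneg) ?_ (hlim C)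
    filter_upwards [eventually_pos_lt hδ.1] with ε hε
    exact happ (hC t ht) ε hε

theorem WeakOn.timeEq (H : WeakOn P u) :
    TimeEq P u fun t x => 1 / 2 * (u t x * deriv (deriv (u t)) x) := fun p hp => by
  have h := H.xReg 1
  have hd : ∀ i ≤ 1, LocDiff P (xderiv u i) (xderiv u (i + 1)) := fun i hi =>
    ⟨(h.holder i (by omega)).mono (by norm_num) le_rfl,
      (h.holder (i + 1) (by omega)).mono (by norm_num) le_rfl, h.hasDerivAt i (by omega)⟩
  have h0 := hd 0 zero_le_one
  have h1 := hd 1 le_rfl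
  filter_upwards [H.eqn p hp, (h0.mul h1).integral_mul_deriv H.isOpen p hp,
    (h1.bdd.mul h1.bdd).integrable p hp, (h0.bdd.mul h1.bdd_deriv).integrable p hp]
    with δ hE hI i1 i2 t ht φ hφ
  refine (hE t ht φ hφ).congr_deriv ?_
  have e := hI t ht φ hφ
  have e1 : ∀ y, (xderiv u (0 + 1) t y * xderiv u 1 t y + xderiv u 0 t y * xderiv u (1 + 1) t y)
      * φ y = xderiv u 1 t y * xderiv u 1 t y * φ y + xderiv u 0 t y * xderiv u (1 + 1) t y * φ y :=
    fun y => by ring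
  simp only [e1] at e
  rw [integral_add (i1 t ht φ hφ) (i2 t ht φ hφ)] at e
  simp only [xderiv] at e
  simp only [mul_assoc (1 / 2 : ℝ)]
  rw [e, integral_const_mul]
  ring

theorem WeakOn.exists_timeEq (H : WeakOn P u) (n : ℕ) :
    ∃ S, PolyIn (xderiv u) (n + 2) S ∧ TimeEq P (xderiv u n) S := by
  induction n with
  | zero => exact ⟨_, (PolyIn.const _).mul ((PolyIn.var 0 (by omega)).mul (.var 2 le_rfl)),
      H.timeEq⟩
  | succ n ih =>
    obtain ⟨S, hS, hE⟩ := ih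
    obtain ⟨S', hS', hd⟩ := hS.exists_deriv
    have h := H.xReg (n + 2)
    have bdd : ∀ i ≤ n + 3, LocHolder P 0 (xderiv u i) := fun i hi =>
      (h.holder i hi).mono (by norm_num) le_rfl
    exact ⟨S', hS', hE.deriv H.isOpen
      ⟨bdd n (by omega), bdd (n + 1) (by omega), h.hasDerivAt n (by omega)⟩
      ⟨hS.locHolder fun i hi => bdd i (by omega), hS'.locHolder bdd,
        fun p hp => hd p.1 p.2 fun i hi => h.hasDerivAt i (by omega) p hp⟩⟩

theorem WeakOn.exists_hasDerivAt_time (H : WeakOn P u) (n : ℕ) :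
    ∃ S, PolyIn (xderiv u) (n + 2) S ∧
      ∀ p ∈ P, HasDerivAt (fun s => xderiv u n s p.2) (S p.1 p.2) p.1 := by
  obtain ⟨S, hS, hE⟩ := H.exists_timeEq n
  have h := H.xReg (n + 1)
  exact ⟨S, hS, hE.hasDerivAt (by norm_num) (h.holder n (by omega)) (hS.locHolder h.holder)⟩

theorem WeakOn.hasDerivAt_time (H : WeakOn P u) : ∀ p ∈ P,
    HasDerivAt (fun s => u s p.2) (1 / 2 * (u p.1 p.2 * deriv (deriv (u p.1)) p.2)) p.1 := by
  have h := H.xReg 1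
  exact H.timeEq.hasDerivAt (by norm_num) (h.holder 0 (by omega))
    ((LocHolder.const _).mul ((h.holder 0 (by omega)).mul (h.holder 2 le_rfl)))

end TimeEq

section Smooth

variable {P : Set (ℝ × ℝ)} {u v : ℝ → ℝ → ℝ}

theorem LocHolder.continuousAt (hv : LocHolder P 1 v) {p : ℝ × ℝ} (hp : p ∈ P)
    (ht : ContinuousAt (fun s => v s p.2) p.1) : ContinuousAt (Function.uncurry v) p := by
  obtain ⟨C, hC⟩ := hv p hp
  obtain ⟨δ, hC, hδ⟩ := (hC.and (eventually_pos_lt one_pos)).exists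
  have h1 : ContinuousAt (fun q : ℝ × ℝ => v q.1 p.2) p :=
    ContinuousAt.comp (f := Prod.fst) (g := fun s => v s p.2) ht continuousAt_fst
  have h2 : Tendsto (fun q : ℝ × ℝ => v q.1 q.2 - v q.1 p.2) (nhds p) (nhds 0) := by
    have h3 : Tendsto (fun q : ℝ × ℝ => C * |q.2 - p.2|) (nhds p) (nhds 0) := by
      have : Continuous fun q : ℝ × ℝ => C * |q.2 - p.2| := by fun_prop
      simpa using this.tendsto p
    refine squeeze_zero_norm' ?_ h3
    filter_upwards [Metric.ball_mem_nhds p hδ.1] with q hq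
    rw [Metric.mem_ball, Prod.dist_eq, max_lt_iff] at hq
    simpa using (hC q.1 hq.1).holder q.2 p.2 hq.2.le (by simpa using hδ.1.le)
  have h4 := h2.add h1
  simp only [sub_add_cancel, zero_add] at h4
  exact h4

theorem WeakOn.continuousOn_xderiv (H : WeakOn P u) (n : ℕ) :
    ContinuousOn (Function.uncurry (xderiv u n)) P := fun p hp => by
  obtain ⟨S, -, hS⟩ := H.exists_hasDerivAt_time n
  exact (((H.xReg n).lip H.isOpen (Nat.lt_succ_self n)).continuousAt hp
    (hS p hp).continuousAt).continuousWithinAt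

theorem PolyIn.contDiffOn {w : ℕ → ℝ → ℝ → ℝ} {n : ℕ} {g : ℝ → ℝ → ℝ} (hg : PolyIn w n g)
    {N : ℕ} (hw : ∀ i, ContDiffOn ℝ N (Function.uncurry (w i)) P) :
    ContDiffOn ℝ N (Function.uncurry g) P := by
  induction hg with
  | var i hi => exact hw i
  | const a => exact contDiffOn_const
  | add _ _ h1 h2 => exact h1.add h2
  | mul _ _ h1 h2 => exact h1.mul h2

theorem hasFDerivAt_uncurry {v₁ v₂ : ℝ → ℝ → ℝ} (hP : IsOpen P)
    (h1 : ∀ p ∈ P, HasDerivAt (fun s => v s p.2) (v₁ p.1 p.2) p.1)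
    (h2 : ∀ p ∈ P, HasDerivAt (v p.1) (v₂ p.1 p.2) p.2)
    (c1 : ContinuousOn (Function.uncurry v₁) P) (c2 : ContinuousOn (Function.uncurry v₂) P)
    {p : ℝ × ℝ} (hp : p ∈ P) :
    HasFDerivAt (Function.uncurry v) (Function.uncurry v₁ p • ContinuousLinearMap.fst ℝ ℝ ℝ
      + Function.uncurry v₂ p • ContinuousLinearMap.snd ℝ ℝ ℝ) p := by
  have hmem := hP.mem_nhds hp
  have key := hasStrictFDerivAt_uncurry_coprod (𝕜 := ℝ) (u := p) (f := v)
    (f₁ := fun t x => ContinuousLinearMap.toSpanSingleton ℝ (v₁ t x))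
    (f₂ := fun t x => ContinuousLinearMap.toSpanSingleton ℝ (v₂ t x))
    (by filter_upwards [hmem] with q hq using (h1 q hq).hasFDerivAt)
    (by filter_upwards [hmem] with q hq using (h2 q hq).hasFDerivAt)
    ((ContinuousLinearMap.toSpanSingletonCLE (𝕜 := ℝ) (E := ℝ)).continuous.continuousAt.comp
      (c1.continuousAt hmem))
    ((ContinuousLinearMap.toSpanSingletonCLE (𝕜 := ℝ) (E := ℝ)).continuous.continuousAt.comp
      (c2.continuousAt hmem))
  refine key.hasFDerivAt.congr_fderiv ?_
  ext <;> simp [Function.HasUncurry.uncurry, Function.uncurry]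

theorem WeakOn.contDiffOn_xderiv (H : WeakOn P u) (N : ℕ) :
    ∀ n, ContDiffOn ℝ N (Function.uncurry (xderiv u n)) P := by
  induction N with
  | zero => exact fun n => contDiffOn_zero.2 (H.continuousOn_xderiv n)
  | succ N ih =>
    intro n
    obtain ⟨S, hS, hd⟩ := H.exists_hasDerivAt_time n
    have cS := hS.contDiffOn ih
    have hF : ∀ p ∈ P, HasFDerivAt (Function.uncurry (xderiv u n))
        (Function.uncurry S p • ContinuousLinearMap.fst ℝ ℝ ℝ
          + Function.uncurry (xderiv u (n + 1)) p • ContinuousLinearMap.snd ℝ ℝ ℝ) p :=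
      fun p hp => hasFDerivAt_uncurry H.isOpen hd ((H.xReg n).hasDerivAt n (Nat.lt_succ_self n))
        cS.continuousOn (H.continuousOn_xderiv _) hp
    rw [Nat.cast_succ, contDiffOn_succ_iff_fderiv_of_isOpen H.isOpen]
    refine ⟨fun p hp => (hF p hp).differentiableAt.differentiableWithinAt, by simp, ?_⟩
    exact ((cS.smul contDiffOn_const).add ((ih (n + 1)).smul contDiffOn_const)).congr
      fun p hp => (hF p hp).fderiv

end Smooth

section Positive

variable {T : ℝ} {u : ℝ → ℝ → ℝ}

theorem RegWeak.isOpen_pos (hu : RegWeak T u) :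
    IsOpen {p : ℝ × ℝ | p.1 ∈ Ioo (0:ℝ) T ∧ 0 < u p.1 p.2} := by
  have h := (hu.1.mono (prod_mono_left Ioo_subset_Ico_self)).isOpen_inter_preimage
    (isOpen_Ioo.prod isOpen_univ) (isOpen_Ioi (a := (0:ℝ)))
  convert h using 1
  ext p
  simp [Function.uncurry]

theorem eventually_forall_near {p : ℝ × ℝ} {Q : ℝ → Prop} (h : ∀ᶠ t in nhds p.1, Q t) :
    ∀ᶠ δ in nhdsWithin (0:ℝ) (Ioi 0), ∀ t, |t - p.1| < δ → Q t := by
  obtain ⟨η, hη, h⟩ := Metric.eventually_nhds_iff.1 h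
  filter_upwards [eventually_pos_lt hη] with δ hδ t ht
  exact h (ht.trans hδ.2)

theorem IsWeakSolution.weakOn (hu : IsWeakSolution T u) :
    WeakOn {p : ℝ × ℝ | p.1 ∈ Ioo (0:ℝ) T ∧ 0 < u p.1 p.2} u := by
  have hP := hu.2.1.isOpen_pos
  have hIoo : ∀ p ∈ {p : ℝ × ℝ | p.1 ∈ Ioo (0:ℝ) T ∧ 0 < u p.1 p.2},
      ∀ᶠ δ in nhdsWithin (0:ℝ) (Ioi 0), ∀ t, |t - p.1| < δ → t ∈ Ioo 0 T := fun p hp =>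
    eventually_forall_near (isOpen_Ioo.mem_nhds hp.1)
  refine ⟨hP, fun p hp => ?_, fun p hp => ?_, fun p hp => ?_, fun p hp => ?_, fun p hp => ?_⟩
  · have hc : ContinuousAt (Function.uncurry u) p := hu.2.1.1.continuousAt
      (prod_mem_nhds (Ico_mem_nhds hp.1.1 hp.1.2) univ_mem)
    obtain ⟨η, hη, h⟩ := Metric.eventually_nhds_iff.1
      (hc.eventually (lt_mem_nhds (half_lt_self hp.2)))
    refine ⟨u p.1 p.2 / 2, half_pos hp.2, ?_⟩
    filter_upwards [eventually_pos_lt hη] with δ hδ t x ht hx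
    refine (h (y := (t, x)) ?_).le
    rw [Prod.dist_eq, max_lt_iff]
    exact ⟨ht.trans_lt hδ.2, hx.trans_lt hδ.2⟩
  · obtain ⟨C, hC⟩ := hu.2.1.exists_holderNear hp.1 p.2 1
    refine ⟨C, ?_⟩
    filter_upwards [eventually_forall_near hC, eventually_pos_lt one_pos] with δ h hδ t ht
    exact (h t ht).2.1.mono (by simpa using hδ.2.le) le_rfl
  · obtain ⟨C, hC⟩ := hu.2.1.exists_holderNear hp.1 p.2 1
    refine ⟨C, ?_⟩
    filter_upwards [eventually_forall_near hC, eventually_pos_lt one_pos] with δ h hδ t ht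
    exact (h t ht).2.2.mono (by simpa using hδ.2.le) le_rfl
  · filter_upwards [hIoo p hp] with δ h t ht φ hφ
    exact hu.hasDerivAt_integral (h t ht) hφ
  · filter_upwards [hIoo p hp] with δ h t ht φ hφ
    exact hu.hasDerivAt_integral_deriv (h t ht) hφ

end Positive

/-- A weak solution of `∂ₜ u = (1/2) u ∂ₓ² u` on `[0,T)` is smooth
on its positivity set `P = {(t,x) ∈ (0,T) × ℝ : u(t,x) > 0}` and satisfies the PDE
pointwise there. -/
theorem positive_smoothness (T : ℝ) (hT : 0 < T) (u : ℝ → ℝ → ℝ)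
    (hu : IsWeakSolution T u) :
    ContDiffOn ℝ (⊤ : ℕ∞) (Function.uncurry u)
      {p : ℝ × ℝ | p.1 ∈ Ioo (0:ℝ) T ∧ 0 < u p.1 p.2} ∧
    ∀ p : ℝ × ℝ, p.1 ∈ Ioo (0:ℝ) T → 0 < u p.1 p.2 →
      deriv (fun s => u s p.2) p.1 = (1/2) * u p.1 p.2 * deriv (deriv (u p.1)) p.2 := by
  refine ⟨contDiffOn_infty.2 fun N => hu.weakOn.contDiffOn_xderiv N 0, fun p hp hpos => ?_⟩
  rw [(hu.weakOn.hasDerivAt_time p ⟨hp, hpos⟩).deriv, mul_assoc]
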